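/- arXiv:2010.09513 — 5 statements merged into one kernel-verified Lean document; each statement's English description precedes it below -/
import Mathlib

section
/- For every n ≥ 1, Σ_{π∈B_n, π(1)>0} x^{des_B(π)} = Σ_{π∈B_n, π(n)>0} x^{des_B(π)} and Σ_{π∈B_n, π(1)<0} x^{des_B(π)} = Σ_{π∈B_n, π(n)<0} x^{des_B(π)}. Consequently C_n^E(x) = P_n(x), where P_n(x) = Σ_{π∈B_n, π(n)>0} x^{des_B(π)}. -/
open Polynomial Finset

/-- A signed permutation of rank `n`, encoded as a permutation of `Fin n`
together with a sign for each position. -/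
abbrev SPerm (n : ℕ) := Equiv.Perm (Fin n) × (Fin n → Bool)

/-- The value `π(i)` of a signed permutation at position `i ∈ [n]` (1-indexed),
with the convention `π(0) = 0` (and value `0` outside `[0, n]`). -/
def sval (n : ℕ) (π : SPerm n) (i : ℕ) : ℤ :=
  if h : 1 ≤ i ∧ i ≤ n then
    (if π.2 ⟨i - 1, by omega⟩ then -1 else 1) * ((π.1 ⟨i - 1, by omega⟩ : Fin n).val + 1)
  else 0

/-- `des_A(π) = #{i ∈ [n-1] : π(i) > π(i+1)}`. -/
def desA (n : ℕ) (π : SPerm n) : ℕ :=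
  ((Finset.Icc 1 (n - 1)).filter (fun i => sval n π (i + 1) < sval n π i)).card

/-- `des_B(π) = #{i ∈ {0,…,n-1} : π(i) > π(i+1)}`, where `π(0) = 0`. -/
def desB (n : ℕ) (π : SPerm n) : ℕ :=
  ((Finset.Icc 0 (n - 1)).filter (fun i => sval n π (i + 1) < sval n π i)).card

/-- The flag descent number `fdes(π)`. -/
def fdes (n : ℕ) (π : SPerm n) : ℕ :=
  if sval n π 1 < 0 then 2 * desA n π + 1 else 2 * desA n π

/-- The flag descent polynomial `C_n(x) = Σ_{π ∈ B_n} x^{fdes(π)}`. -/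
noncomputable def Cpoly (n : ℕ) : Polynomial ℝ :=
  ∑ π : SPerm n, X ^ fdes n π

/-- The type `B` Eulerian polynomial `B_n(x) = Σ_{π ∈ B_n} x^{des_B(π)}`. -/
noncomputable def Bpoly (n : ℕ) : Polynomial ℝ :=
  ∑ π : SPerm n, X ^ desB n π

/-- `C_n^E(x) = Σ_{π ∈ B_n, π(1) > 0} x^{des_A(π)}`. -/
noncomputable def CEpoly (n : ℕ) : Polynomial ℝ :=
  ∑ π ∈ Finset.univ.filter (fun π : SPerm n => 0 < sval n π 1), X ^ desA n π

/-- `C_n^O(x) = Σ_{π ∈ B_n, π(1) < 0} x^{des_A(π)}`. -/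
noncomputable def COpoly (n : ℕ) : Polynomial ℝ :=
  ∑ π ∈ Finset.univ.filter (fun π : SPerm n => sval n π 1 < 0), X ^ desA n π

/-- Complement all absolute values and flip all signs of a signed permutation. -/
def negComplement (n : ℕ) (π : SPerm n) : SPerm n :=
  (π.1.trans Fin.revPerm, fun i => !π.2 i)

theorem negComplement_negComplement (n : ℕ) (π : SPerm n) :
    negComplement n (negComplement n π) = π := by
  refine Prod.ext (Equiv.ext fun i => ?_) (funext fun i => ?_) <;> simp [negComplement]

theorem sval_bounds {n : ℕ} (π : SPerm n) {i : ℕ} (h1 : 1 ≤ i) (hn : i ≤ n) :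
    (1 ≤ sval n π i ∧ sval n π i ≤ n) ∨ (-(n : ℤ) ≤ sval n π i ∧ sval n π i ≤ -1) := by
  have hlt := (π.1 ⟨i - 1, by omega⟩).isLt
  unfold sval
  rw [dif_pos ⟨h1, hn⟩]
  split_ifs <;> omega

theorem sval_negComplement {n : ℕ} (π : SPerm n) {i : ℕ} (h1 : 1 ≤ i) (hn : i ≤ n) :
    sval n (negComplement n π) i =
      sval n π i + if sval n π i < 0 then (n + 1 : ℤ) else -(n + 1) := by
  have hlt := (π.1 ⟨i - 1, by omega⟩).isLt
  unfold sval
  rw [dif_pos ⟨h1, hn⟩, dif_pos ⟨h1, hn⟩]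
  cases hs : π.2 ⟨i - 1, by omega⟩ <;>
    simp only [negComplement, hs, Equiv.trans_apply, Fin.revPerm_apply, Fin.val_rev] <;>
    split_ifs <;> simp_all <;> omega

theorem sval_zero (n : ℕ) (π : SPerm n) : sval n π 0 = 0 := by
  simp [sval]

theorem desB_eq_sum {n : ℕ} (hn : 1 ≤ n) (π : SPerm n) :
    (desB n π : ℤ) = ∑ i ∈ range n, if sval n π (i + 1) < sval n π i then 1 else 0 := by
  have : Icc 0 (n - 1) = range n := by ext; simp; omega
  rw [desB, this, card_filter]
  push_cast
  rfl

/-- Among the first `k` gaps, `negComplement` changes the number of descents by an amount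
depending only on the signs of the first and the `k`-th entries. -/
theorem sum_descents_negComplement {n : ℕ} (π : SPerm n) {k : ℕ} (h1 : 1 ≤ k) (hk : k ≤ n) :
    (∑ i ∈ range k, if sval n π (i + 1) < sval n π i then (1 : ℤ) else 0) + 1 =
      (∑ i ∈ range k, if sval n (negComplement n π) (i + 1) < sval n (negComplement n π) i
        then (1 : ℤ) else 0) +
      (if sval n π k < 0 then 1 else 0) + (if sval n π 1 < 0 then 1 else 0) := by
  induction k, h1 using Nat.le_induction with
  | base =>
    have hb := sval_bounds π le_rfl hk
    have hc := sval_negComplement π le_rfl hk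
    simp only [sum_range_one, sval_zero, zero_add]
    split_ifs at * <;> omega
  | succ k h1 ih =>
    have ih := ih (by omega)
    have hb := sval_bounds π h1 (by omega)
    have hc := sval_negComplement π h1 (by omega)
    have hb' := sval_bounds π (by omega) hk
    have hc' := sval_negComplement π (by omega) hk
    rw [sum_range_succ, sum_range_succ]
    split_ifs at * <;> omega

theorem desB_negComplement {n : ℕ} (hn : 1 ≤ n) (π : SPerm n)
    (h : ¬(0 < sval n π 1 ↔ 0 < sval n π n)) :
    desB n (negComplement n π) = desB n π := by
  have hs := sum_descents_negComplement π hn le_rfl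
  rw [← desB_eq_sum hn, ← desB_eq_sum hn] at hs
  have h1 := sval_bounds π le_rfl hn
  have hb := sval_bounds π hn le_rfl
  split_ifs at hs <;> omega

theorem sval_negComplement_pos_iff {n : ℕ} (π : SPerm n) {i : ℕ} (h1 : 1 ≤ i) (hn : i ≤ n) :
    0 < sval n (negComplement n π) i ↔ ¬ 0 < sval n π i := by
  have hb := sval_bounds π h1 hn
  have hc := sval_negComplement π h1 hn
  split_ifs at hc <;> omega

/-- The involution applying `negComplement` when the first and last entries have opposite
signs. -/
def endSwap (n : ℕ) (π : SPerm n) : SPerm n :=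
  if 0 < sval n π 1 ↔ 0 < sval n π n then π else negComplement n π

theorem endSwap_involutive {n : ℕ} (hn : 1 ≤ n) : Function.Involutive (endSwap n) := by
  intro π
  by_cases h : 0 < sval n π 1 ↔ 0 < sval n π n
  · simp only [endSwap, if_pos h]
  · have h' : ¬(0 < sval n (negComplement n π) 1 ↔ 0 < sval n (negComplement n π) n) := by
      rwa [sval_negComplement_pos_iff π le_rfl hn, sval_negComplement_pos_iff π hn le_rfl,
        not_iff_not]
    simp only [endSwap, if_neg h, if_neg h', negComplement_negComplement]

theorem desB_endSwap {n : ℕ} (hn : 1 ≤ n) (π : SPerm n) :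
    desB n (endSwap n π) = desB n π := by
  unfold endSwap
  split_ifs with h
  · rfl
  · exact desB_negComplement hn π h

theorem sval_last_endSwap_pos_iff {n : ℕ} (hn : 1 ≤ n) (π : SPerm n) :
    0 < sval n (endSwap n π) n ↔ 0 < sval n π 1 := by
  unfold endSwap
  split_ifs with h
  · exact h.symm
  · rw [sval_negComplement_pos_iff π hn le_rfl]
    tauto

theorem sval_last_endSwap_neg_iff {n : ℕ} (hn : 1 ≤ n) (π : SPerm n) :
    sval n (endSwap n π) n < 0 ↔ sval n π 1 < 0 := by
  have h := sval_last_endSwap_pos_iff hn π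
  have h1 := sval_bounds π le_rfl hn
  have hb := sval_bounds (endSwap n π) hn le_rfl
  omega

theorem desA_eq_desB {n : ℕ} (π : SPerm n) (h : 0 < sval n π 1) :
    desA n π = desB n π := by
  unfold desA desB
  congr 1
  ext i
  rcases Nat.eq_zero_or_pos i with rfl | hi
  · simp [sval_zero, h.le]
  · simp [Nat.one_le_iff_ne_zero, hi.ne']

/-- For every `n ≥ 1`, the generating polynomial of `des_B` over `{π : π(1) > 0}`
equals the one over `{π : π(n) > 0}`, and likewise for the negative versions;
consequently `C_n^E(x) = P_n(x) = Σ_{π(n) > 0} x^{des_B(π)}`. -/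
theorem first_last_entry_desB_equidistribution (n : ℕ) (hn : 1 ≤ n) :
    ((∑ π ∈ Finset.univ.filter (fun π : SPerm n => 0 < sval n π 1),
        (X : Polynomial ℝ) ^ desB n π) =
      ∑ π ∈ Finset.univ.filter (fun π : SPerm n => 0 < sval n π n),
        (X : Polynomial ℝ) ^ desB n π) ∧
    ((∑ π ∈ Finset.univ.filter (fun π : SPerm n => sval n π 1 < 0),
        (X : Polynomial ℝ) ^ desB n π) =
      ∑ π ∈ Finset.univ.filter (fun π : SPerm n => sval n π n < 0),
        (X : Polynomial ℝ) ^ desB n π) ∧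
    CEpoly n =
      ∑ π ∈ Finset.univ.filter (fun π : SPerm n => 0 < sval n π n),
        (X : Polynomial ℝ) ^ desB n π := by
  have pos : (∑ π ∈ Finset.univ.filter (fun π : SPerm n => 0 < sval n π 1),
        (X : Polynomial ℝ) ^ desB n π) =
      ∑ π ∈ Finset.univ.filter (fun π : SPerm n => 0 < sval n π n),
        (X : Polynomial ℝ) ^ desB n π :=
    sum_equiv (endSwap_involutive hn).toPerm
      (fun π => by simp [sval_last_endSwap_pos_iff hn])
      (fun π _ => by simp [desB_endSwap hn])
  refine ⟨pos, ?_, ?_⟩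
  · exact sum_equiv (endSwap_involutive hn).toPerm
      (fun π => by simp [sval_last_endSwap_neg_iff hn])
      (fun π _ => by simp [desB_endSwap hn])
  · rw [← pos]
    refine sum_congr rfl fun π hπ => ?_
    rw [desA_eq_desB π (mem_filter.mp hπ).2]
end

section
/- Let (E_n(x))_{n≥0}, (O_n(x))_{n≥0}, (F_n(x))_{n≥0} be sequences of real polynomials, and let p_n, q_n, r_n, u_n, v_n, w_n, α_n, β_n be real polynomials such that E_{n+1}(x) = p_n(x)E_n(x) + q_n(x)E_n′(x) + r_n(x)O_n(x), O_{n+1}(x) = u_n(x)O_n(x) + v_n(x)O_n′(x) + w_n(x)E_n(x), and F_{n+1}(x) = α_n(x)F_n(x) + β_n(x)F_n′(x) for all n ≥ 0, with F_0(x) = E_0(x^2) + x·O_0(x^2). If for all n the polynomial identities 2x·u_n(x) = 2x·p_n(x) + q_n(x), v_n(x) = q_n(x), x·w_n(x) = r_n(x), x·α_n(x) = x·p_n(x^2) + r_n(x^2), and 2x·β_n(x) = q_n(x^2) hold, then F_n(x) = E_n(x^2) + x·O_n(x^2) for all n ≥ 0. -/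
open Polynomial

/-- Duality between a Eulerian recurrence and a Eulerian recurrence system:
if `E_{n+1} = p_n E_n + q_n E_n' + r_n O_n`, `O_{n+1} = u_n O_n + v_n O_n' + w_n E_n`,
`F_{n+1} = α_n F_n + β_n F_n'` with `F_0(x) = E_0(x²) + x·O_0(x²)`, and the
compatibility relations `2x·u_n(x) = 2x·p_n(x) + q_n(x)`, `v_n = q_n`,
`x·w_n(x) = r_n(x)`, `x·α_n(x) = x·p_n(x²) + r_n(x²)`, `2x·β_n(x) = q_n(x²)`
hold, then `F_n(x) = E_n(x²) + x·O_n(x²)` for all `n`. -/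
theorem eulerian_pair_duality
    (E O F p q r u v w α β : ℕ → Polynomial ℝ)
    (hE : ∀ n, E (n + 1) = p n * E n + q n * derivative (E n) + r n * O n)
    (hO : ∀ n, O (n + 1) = u n * O n + v n * derivative (O n) + w n * E n)
    (hF : ∀ n, F (n + 1) = α n * F n + β n * derivative (F n))
    (hF0 : F 0 = (E 0).comp (X ^ 2) + X * (O 0).comp (X ^ 2))
    (hu : ∀ n, 2 * X * u n = 2 * X * p n + q n)
    (hv : ∀ n, v n = q n)
    (hw : ∀ n, X * w n = r n)
    (hα : ∀ n, X * α n = X * (p n).comp (X ^ 2) + (r n).comp (X ^ 2))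
    (hβ : ∀ n, 2 * X * β n = (q n).comp (X ^ 2)) :
    ∀ n, F n = (E n).comp (X ^ 2) + X * (O n).comp (X ^ 2) := by
  intro n
  induction n with
  | zero => exact hF0
  | succ n ih =>
    have hU : 2 * X ^ 2 * (u n).comp (X ^ 2) =
        2 * X ^ 2 * (p n).comp (X ^ 2) + (q n).comp (X ^ 2) := by
      simpa only [Polynomial.mul_comp, add_comp, X_comp, ofNat_comp, Nat.cast_ofNat]
        using congrArg (fun f : ℝ[X] => f.comp (X ^ 2)) (hu n)
    have hW : X ^ 2 * (w n).comp (X ^ 2) = (r n).comp (X ^ 2) := by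
      simpa only [Polynomial.mul_comp, X_comp]
        using congrArg (fun f : ℝ[X] => f.comp (X ^ 2)) (hw n)
    have hX : (2 * X : ℝ[X]) ≠ 0 := mul_ne_zero two_ne_zero X_ne_zero
    apply mul_left_cancel₀ hX
    rw [hF, ih, hE, hO, hv]
    simp only [derivative_add, derivative_mul, derivative_comp, derivative_X, derivative_X_sq,
      add_comp, Polynomial.mul_comp, map_ofNat]
    linear_combination
      2 * ((E n).comp (X ^ 2) + X * (O n).comp (X ^ 2)) * hα n
        + (2 * X * (derivative (E n)).comp (X ^ 2) + (O n).comp (X ^ 2)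
          + 2 * X ^ 2 * (derivative (O n)).comp (X ^ 2)) * hβ n
        - (O n).comp (X ^ 2) * hU - 2 * (E n).comp (X ^ 2) * hW
end

section
/- For every n ≥ 2, both C_n^E(x) and C_n^O(x) have only real negative zeros, and C_n^O(x) ≺ C_n^E(x), i.e., since both have degree n−1, the zeros ξ_1 ≤ … ≤ ξ_{n−1} of C_n^O and θ_1 ≤ … ≤ θ_{n−1} of C_n^E satisfy ξ_1 ≤ θ_1 ≤ ξ_2 ≤ θ_2 ≤ … ≤ ξ_{n−1} ≤ θ_{n−1}. -/
open Polynomial Finset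

/-- Prepend the letter of absolute value `p + 1` (negative iff `s`) to a signed permutation,
shifting the remaining absolute values to make room for it. -/
def signedCons {n : ℕ} (p : Fin (n + 1)) (s : Bool) (τ : SPerm n) : SPerm (n + 1) :=
  (((finSuccEquiv' 0).trans (Equiv.optionCongr τ.1)).trans (finSuccEquiv' p).symm, Fin.cons s τ.2)

lemma signedCons_fst_zero {n : ℕ} (p : Fin (n + 1)) (s : Bool) (τ : SPerm n) :
    (signedCons p s τ).1 0 = p := by
  simp [signedCons]

lemma signedCons_fst_succ {n : ℕ} (p : Fin (n + 1)) (s : Bool) (τ : SPerm n) (i : Fin n) :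
    (signedCons p s τ).1 i.succ = p.succAbove (τ.1 i) := by
  have : (finSuccEquiv' (0 : Fin (n + 1))) i.succ = some i := by
    rw [← Fin.zero_succAbove, finSuccEquiv'_succAbove]
  simp [signedCons, this]

lemma signedCons_bijective (n : ℕ) :
    Function.Bijective
      (fun x : (Fin (n + 1) × Bool) × SPerm n => signedCons x.1.1 x.1.2 x.2) := by
  rw [Fintype.bijective_iff_injective_and_card]
  constructor
  · rintro ⟨⟨p, s⟩, τ⟩ ⟨⟨q, t⟩, ρ⟩ h
    simp only at h
    have h0 : p = q := by
      rw [← signedCons_fst_zero p s τ, h, signedCons_fst_zero]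
    subst h0
    have h2 : (Fin.cons s τ.2 : Fin (n + 1) → Bool) = Fin.cons t ρ.2 := congrArg Prod.snd h
    obtain ⟨rfl, h3⟩ := Fin.cons_injective2 h2
    have h4 : τ.1 = ρ.1 := by
      ext1 i
      apply Fin.succAbove_right_injective (p := p)
      rw [← signedCons_fst_succ p s τ, h, signedCons_fst_succ]
    rw [Prod.ext h4 h3]
  · simp only [Fintype.card_prod, Fintype.card_perm, Fintype.card_fin, Fintype.card_bool,
      Fintype.card_fun, Nat.factorial_succ, pow_succ]
    ring

lemma sval_signedCons_one {n : ℕ} (p : Fin (n + 1)) (s : Bool) (τ : SPerm n) :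
    sval (n + 1) (signedCons p s τ) 1 = (if s then -1 else 1) * ((p : ℕ) + 1 : ℤ) := by
  rw [sval, dif_pos (by omega)]
  have := signedCons_fst_zero p s τ
  simp only [Nat.sub_self, Fin.mk_zero', this]
  rfl

lemma sval_add_one {n : ℕ} (τ : SPerm n) (i : Fin n) :
    sval n τ (i + 1) = (if τ.2 i then -1 else 1) * ((τ.1 i : ℕ) + 1 : ℤ) := by
  rw [sval, dif_pos (by omega)]
  simp

lemma sval_signedCons_add_two {n : ℕ} (p : Fin (n + 1)) (s : Bool) (τ : SPerm n) (i : Fin n) :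
    sval (n + 1) (signedCons p s τ) (i + 2) =
      (if τ.2 i then -1 else 1) * ((p.succAbove (τ.1 i) : ℕ) + 1 : ℤ) := by
  have := sval_add_one (signedCons p s τ) i.succ
  rw [signedCons_fst_succ] at this
  simpa [signedCons] using this

lemma succAbove_val {n : ℕ} (p : Fin (n + 1)) (q : Fin n) :
    (p.succAbove q : ℕ) = if (q : ℕ) < p then (q : ℕ) else q + 1 := by
  simp only [Fin.succAbove, Fin.lt_def, Fin.val_castSucc]
  split_ifs <;> simp

lemma sval_signedCons_lt_iff {n : ℕ} (p : Fin (n + 1)) (s : Bool) (τ : SPerm n) (i j : Fin n) :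
    sval (n + 1) (signedCons p s τ) (i + 2) < sval (n + 1) (signedCons p s τ) (j + 2) ↔
      sval n τ (i + 1) < sval n τ (j + 1) := by
  simp only [sval_signedCons_add_two, sval_add_one, succAbove_val]
  cases τ.2 i <;> cases τ.2 j <;> simp <;> split_ifs <;> omega

/-- Whether a word starting with the letter encoded by `(p, s)` has a descent there when the
remaining letters standardize to a word starting with the letter encoded by `(q, t)`. -/
def firstDescent (p : ℕ) (s : Bool) (q : ℕ) (t : Bool) : Bool :=
  if s then t && decide (p ≤ q) else t || decide (q < p)

lemma sval_signedCons_signedCons_lt_iff {n : ℕ} (p : Fin (n + 2)) (s : Bool) (q : Fin (n + 1))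
    (t : Bool) (ρ : SPerm n) :
    sval (n + 2) (signedCons p s (signedCons q t ρ)) 2 <
        sval (n + 2) (signedCons p s (signedCons q t ρ)) 1 ↔ firstDescent p s q t = true := by
  have h := sval_signedCons_add_two p s (signedCons q t ρ) 0
  rw [signedCons_fst_zero] at h
  simp only [Fin.val_zero, zero_add] at h
  rw [h, sval_signedCons_one, succAbove_val]
  have : (signedCons q t ρ).2 0 = t := rfl
  rw [this, firstDescent]
  cases s <;> cases t <;> simp <;> split_ifs <;> omega

lemma desA_eq_sum_range (n : ℕ) (π : SPerm n) :
    desA n π = ∑ i ∈ range (n - 1), if sval n π (i + 2) < sval n π (i + 1) then 1 else 0 := by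
  have : Finset.Icc 1 (n - 1) = Finset.Ico 1 (n - 1 + 1) := by
    ext i
    simp only [Finset.mem_Icc, Finset.mem_Ico]
    omega
  rw [desA, Finset.card_filter, this, Finset.sum_Ico_eq_sum_range]
  simp only [Nat.add_sub_cancel, add_comm 1, add_assoc, Nat.reduceAdd]

lemma desA_signedCons_signedCons {n : ℕ} (p : Fin (n + 2)) (s : Bool) (q : Fin (n + 1))
    (t : Bool) (ρ : SPerm n) :
    desA (n + 2) (signedCons p s (signedCons q t ρ)) =
      desA (n + 1) (signedCons q t ρ) + if firstDescent p s q t then 1 else 0 := by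
  rw [desA_eq_sum_range, desA_eq_sum_range]
  simp only [Nat.add_sub_cancel, show n + 2 - 1 = n + 1 from rfl]
  rw [Finset.sum_range_succ']
  congr 1
  · refine Finset.sum_congr rfl fun i hi => ?_
    have hi := Finset.mem_range.1 hi
    have := sval_signedCons_lt_iff p s (signedCons q t ρ) ⟨i + 1, by omega⟩ ⟨i, by omega⟩
    simp only at this
    exact if_congr this rfl rfl
  · exact if_congr (sval_signedCons_signedCons_lt_iff p s q t ρ) rfl rfl

/-- The descent polynomial of signed permutations of rank `n + 1` whose first letter is encoded
by `(p, s)`, defined through the recursion on removing that letter. -/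
noncomputable def firstLetterPoly : ℕ → ℕ → Bool → ℝ[X]
  | 0, _, _ => 1
  | n + 1, p, s => ∑ q ∈ range (n + 1), ∑ t : Bool,
      (if firstDescent p s q t then X else 1) * firstLetterPoly n q t

lemma sum_signedCons_eq_firstLetterPoly (n : ℕ) (p : Fin (n + 1)) (s : Bool) :
    ∑ τ : SPerm n, X ^ desA (n + 1) (signedCons p s τ) = firstLetterPoly n p s := by
  induction n generalizing s with
  | zero => simp [firstLetterPoly, desA, SPerm]
  | succ n ih =>
    rw [firstLetterPoly, Finset.sum_range,
      ← (Equiv.ofBijective _ (signedCons_bijective n)).sum_comp]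
    simp only [Equiv.ofBijective_apply, desA_signedCons_signedCons]
    rw [Fintype.sum_prod_type, Fintype.sum_prod_type]
    refine Finset.sum_congr rfl fun q _ => Finset.sum_congr rfl fun t _ => ?_
    rw [← ih, Finset.mul_sum]
    refine Finset.sum_congr rfl fun ρ _ => ?_
    split_ifs
    · rw [pow_succ, mul_comm]
    · simp

lemma CEpoly_succ (n : ℕ) :
    CEpoly (n + 1) = ∑ q ∈ range (n + 1), firstLetterPoly n q false := by
  rw [CEpoly, Finset.sum_filter, ← (Equiv.ofBijective _ (signedCons_bijective n)).sum_comp,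
    Fintype.sum_prod_type, Fintype.sum_prod_type, Finset.sum_range]
  refine Finset.sum_congr rfl fun q _ => ?_
  rw [← sum_signedCons_eq_firstLetterPoly, Fintype.sum_bool]
  simp only [Equiv.ofBijective_apply, sval_signedCons_one]
  have h : (0 : ℤ) < (q : ℕ) + 1 := by omega
  have h' : ¬ (0 : ℤ) < -1 * ((q : ℕ) + 1) := by omega
  simp only [if_true, Bool.false_eq_true, if_false, one_mul, h, h', Finset.sum_const_zero, zero_add]

lemma COpoly_succ (n : ℕ) :
    COpoly (n + 1) = ∑ q ∈ range (n + 1), firstLetterPoly n q true := by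
  rw [COpoly, Finset.sum_filter, ← (Equiv.ofBijective _ (signedCons_bijective n)).sum_comp,
    Fintype.sum_prod_type, Fintype.sum_prod_type, Finset.sum_range]
  refine Finset.sum_congr rfl fun q _ => ?_
  rw [← sum_signedCons_eq_firstLetterPoly, Fintype.sum_bool]
  simp only [Equiv.ofBijective_apply, sval_signedCons_one]
  have h : ¬ ((q : ℕ) + 1 : ℤ) < 0 := by omega
  have h' : -1 * ((q : ℕ) + 1 : ℤ) < 0 := by omega
  simp only [if_true, Bool.false_eq_true, if_false, one_mul, h, h', Finset.sum_const_zero, add_zero]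

lemma firstLetterPoly_succ_self_false (n : ℕ) :
    firstLetterPoly (n + 1) (n + 1) false = X * (CEpoly (n + 1) + COpoly (n + 1)) := by
  rw [firstLetterPoly, CEpoly_succ, COpoly_succ, ← Finset.sum_add_distrib, Finset.mul_sum]
  refine Finset.sum_congr rfl fun q hq => ?_
  have hq := Finset.mem_range.1 hq
  simp only [Fintype.sum_bool, firstDescent, hq]
  simp
  ring

lemma firstLetterPoly_succ_self_true (n : ℕ) :
    firstLetterPoly (n + 1) (n + 1) true = CEpoly (n + 1) + COpoly (n + 1) := by
  rw [firstLetterPoly, CEpoly_succ, COpoly_succ, ← Finset.sum_add_distrib]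
  refine Finset.sum_congr rfl fun q hq => ?_
  have hq : ¬ n + 1 ≤ q := by have := Finset.mem_range.1 hq; omega
  simp only [Fintype.sum_bool, firstDescent, hq]
  simp
  ring

lemma firstLetterPoly_succ_eq_derivative (n p : ℕ) (hp : p < n + 1) (s : Bool) :
    firstLetterPoly (n + 1) p s = (1 + (2 * (n : ℝ[X]) + 1) * X) * firstLetterPoly n p s
      + 2 * X * (1 - X) * derivative (firstLetterPoly n p s) := by
  induction n generalizing p s with
  | zero =>
    obtain rfl : p = 0 := by omega
    cases s <;> simp [firstLetterPoly, firstDescent] <;> ring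
  | succ n ih =>
    have hlast : ∑ t : Bool, (if firstDescent p s (n + 1) t then X else 1) *
        firstLetterPoly (n + 1) (n + 1) t =
        ∑ q ∈ range (n + 1), ∑ t : Bool, 2 * X * firstLetterPoly n q t := by
      have h1 : p ≤ n + 1 := by omega
      have h2 : ¬ n + 1 < p := by omega
      have h3 : ∑ q ∈ range (n + 1), ∑ t : Bool, 2 * X * firstLetterPoly n q t =
          2 * X * (CEpoly (n + 1) + COpoly (n + 1)) := by
        simp only [← Finset.mul_sum, Fintype.sum_bool, Finset.sum_add_distrib, CEpoly_succ,
          COpoly_succ]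
        ring
      rw [h3, Fintype.sum_bool, firstLetterPoly_succ_self_false, firstLetterPoly_succ_self_true]
      cases s <;> simp [firstDescent, h1, h2] <;> ring
    rw [firstLetterPoly, Finset.sum_range_succ, hlast, firstLetterPoly]
    simp only [derivative_sum, Finset.mul_sum, ← Finset.sum_add_distrib]
    refine Finset.sum_congr rfl fun q hq => Finset.sum_congr rfl fun t _ => ?_
    rw [ih q (Finset.mem_range.1 hq) t]
    split_ifs <;> simp only [derivative_mul, derivative_X, derivative_one] <;> push_cast <;> ring

lemma CEpoly_add_two (n : ℕ) :
    CEpoly (n + 2) = (1 + (2 * (n : ℝ[X]) + 2) * X) * CEpoly (n + 1) + X * COpoly (n + 1)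
      + 2 * X * (1 - X) * derivative (CEpoly (n + 1)) := by
  rw [CEpoly_succ (n + 1), Finset.sum_range_succ, firstLetterPoly_succ_self_false,
    Finset.sum_congr rfl fun q hq =>
      firstLetterPoly_succ_eq_derivative n q (Finset.mem_range.1 hq) false,
    Finset.sum_add_distrib, ← Finset.mul_sum, ← Finset.mul_sum, ← derivative_sum, ← CEpoly_succ]
  ring

lemma COpoly_add_two (n : ℕ) :
    COpoly (n + 2) = (2 + (2 * (n : ℝ[X]) + 1) * X) * COpoly (n + 1) + CEpoly (n + 1)
      + 2 * X * (1 - X) * derivative (COpoly (n + 1)) := by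
  rw [COpoly_succ (n + 1), Finset.sum_range_succ, firstLetterPoly_succ_self_true,
    Finset.sum_congr rfl fun q hq =>
      firstLetterPoly_succ_eq_derivative n q (Finset.mem_range.1 hq) true,
    Finset.sum_add_distrib, ← Finset.mul_sum, ← Finset.mul_sum, ← derivative_sum, ← COpoly_succ]
  ring

/-- The type `A` Eulerian polynomial of rank `n + 1`. -/
noncomputable def eulerianPoly : ℕ → ℝ[X]
  | 0 => 1
  | n + 1 => (1 + ((n : ℝ[X]) + 1) * X) * eulerianPoly n + X * (1 - X) * derivative (eulerianPoly n)

lemma expand_CEpoly_add_expand_COpoly (n : ℕ) :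
    expand ℝ 2 (CEpoly (n + 1)) + X * expand ℝ 2 (COpoly (n + 1)) =
      (1 + X) ^ (n + 1) * eulerianPoly n := by
  induction n with
  | zero => simp [CEpoly_succ, COpoly_succ, firstLetterPoly, eulerianPoly]
  | succ n ih =>
    have hd := congrArg derivative ih
    rw [CEpoly_add_two, COpoly_add_two, eulerianPoly]
    simp only [map_add, map_mul, map_sub, map_one, expand_X, map_natCast, map_ofNat,
      derivative_mul, derivative_X, derivative_expand, derivative_pow, derivative_one] at hd ⊢
    push_cast at hd ⊢
    linear_combination (1 + X + 2 * ((n : ℝ[X]) + 1) * X ^ 2) * ih + X * (1 - X ^ 2) * hd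

lemma expand_two_add_X_mul_injective {E O E' O' : ℝ[X]}
    (h : expand ℝ 2 E + X * expand ℝ 2 O = expand ℝ 2 E' + X * expand ℝ 2 O') :
    E = E' ∧ O = O' := by
  have heven (O : ℝ[X]) (k : ℕ) : (X * expand ℝ 2 O).coeff (k * 2) = 0 := by
    rcases k with _ | k
    · simp
    · rw [show (k + 1) * 2 = (k * 2 + 1) + 1 by ring, coeff_X_mul, coeff_expand two_pos,
        if_neg (by omega)]
  have hodd (E : ℝ[X]) (k : ℕ) : (expand ℝ 2 E).coeff (k * 2 + 1) = 0 := by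
    rw [coeff_expand two_pos, if_neg (by omega)]
  constructor <;> ext k
  · simpa [heven, coeff_expand_mul two_pos] using congrArg (fun P => P.coeff (k * 2)) h
  · simpa [hodd, coeff_X_mul, coeff_expand_mul two_pos] using
      congrArg (fun P => P.coeff (k * 2 + 1)) h

lemma eventually_neg_one_pow_mul_eval_neg_pos {P : ℝ[X]} {k : ℕ} (hdeg : P.natDegree ≤ k)
    (hc : 0 < P.coeff k) : ∀ᶠ t in Filter.atTop, 0 < (-1) ^ k * P.eval (-t) := by
  have hk : P.natDegree = k := le_antisymm hdeg (le_natDegree_of_ne_zero hc.ne')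
  rcases Nat.eq_zero_or_pos k with rfl | hpos
  · rw [eq_C_of_natDegree_eq_zero hk]
    exact Filter.Eventually.of_forall fun _ => by simpa using hc
  · set Q : ℝ[X] := C ((-1) ^ k) * P.comp (-X) with hQ
    have hne : ((-1 : ℝ) ^ k) ≠ 0 := pow_ne_zero _ (by norm_num)
    have hX : (-X : ℝ[X]).natDegree ≠ 0 := by simp
    have hdegQ : Q.natDegree = k := by
      rw [hQ, natDegree_C_mul hne, natDegree_comp, hk]
      simp
    have hlead : Q.leadingCoeff = P.coeff k := by
      rw [hQ, leadingCoeff_mul, leadingCoeff_C, leadingCoeff_comp hX, leadingCoeff_neg,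
        leadingCoeff_X, hk, leadingCoeff, hk, mul_left_comm, ← mul_pow]
      simp
    have := Q.tendsto_atTop_of_leadingCoeff_nonneg
      (natDegree_pos_iff_degree_pos.1 (by omega)) (by rw [hlead]; exact hc.le)
    filter_upwards [this.eventually_gt_atTop 0] with t ht
    simpa [hQ] using ht

lemma natDegree_prod_X_add_C (s : Finset ℕ) (r : ℕ → ℝ) :
    (∏ i ∈ s, (X + C (r i))).natDegree = s.card := by
  rw [natDegree_prod_of_monic _ _ fun i _ => monic_X_add_C (r i)]
  simp

lemma monic_prod_X_add_C (s : Finset ℕ) (r : ℕ → ℝ) : (∏ i ∈ s, (X + C (r i))).Monic :=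
  monic_prod_of_monic _ _ fun i _ => monic_X_add_C (r i)

lemma leadingCoeff_C_mul_prod_X_add_C (a : ℝ) (s : Finset ℕ) (r : ℕ → ℝ) :
    (C a * ∏ i ∈ s, (X + C (r i))).leadingCoeff = a := by
  rw [leadingCoeff_mul, leadingCoeff_C, (monic_prod_X_add_C s r).leadingCoeff, mul_one]

lemma coeff_C_mul_prod_X_add_C (a : ℝ) (k : ℕ) (r : ℕ → ℝ) :
    (C a * ∏ i ∈ range k, (X + C (r i))).coeff k = a := by
  have h := (monic_prod_X_add_C (range k) r).coeff_natDegree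
  rw [natDegree_prod_X_add_C, card_range] at h
  rw [coeff_C_mul, h, mul_one]

lemma natDegree_C_mul_prod_X_add_C_le (a : ℝ) (k : ℕ) (r : ℕ → ℝ) :
    (C a * ∏ i ∈ range k, (X + C (r i))).natDegree ≤ k := by
  refine (natDegree_C_mul_le _ _).trans ?_
  rw [natDegree_prod_X_add_C, card_range]

lemma eq_C_mul_prod_X_add_C {P : ℝ[X]} {k : ℕ} (hdeg : P.natDegree ≤ k) (hc : 0 < P.coeff k)
    {r : ℕ → ℝ} (hr : r.Injective) (hroot : ∀ i < k, P.eval (-r i) = 0) :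
    P = C (P.coeff k) * ∏ i ∈ range k, (X + C (r i)) := by
  have hk : P.natDegree = k := le_antisymm hdeg (le_natDegree_of_ne_zero hc.ne')
  have hP : P ≠ 0 := by rintro rfl; simp at hc
  have hlead := leadingCoeff_C_mul_prod_X_add_C (P.coeff k) (range k) r
  have hR : C (P.coeff k) * ∏ i ∈ range k, (X + C (r i)) ≠ 0 := by
    rw [← leadingCoeff_ne_zero, hlead]
    exact hc.ne'
  refine eq_of_degree_le_of_eval_index_eq (s := range k) (v := fun i => -r i)
    (neg_injective.comp hr).injOn ?_ ?_ ?_ ?_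
  · rw [card_range]
    exact natDegree_le_iff_degree_le.1 hdeg
  · rw [degree_eq_natDegree hP, degree_eq_natDegree hR, natDegree_C_mul hc.ne',
      natDegree_prod_X_add_C, card_range, hk]
  · rw [hlead, leadingCoeff, hk]
  · intro i hi
    rw [hroot i (mem_range.1 hi), eval_mul, eval_prod, prod_eq_zero hi (by simp), mul_zero]

lemma neg_one_pow_mul_eval_prod_pos {s : Finset ℕ} {r : ℕ → ℝ} {t : ℝ} {m : ℕ}
    (hm : range m ⊆ s) (hlt : ∀ i ∈ s, i < m → r i < t) (hgt : ∀ i ∈ s, m ≤ i → t < r i) :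
    0 < (-1) ^ m * (∏ i ∈ s, (X + C (r i))).eval (-t) := by
  have hpow : (-1 : ℝ) ^ m = ∏ i ∈ s, if i < m then -1 else 1 := by
    have : s.filter (· < m) = range m := by
      ext i
      simp only [mem_filter, mem_range]
      exact ⟨fun h => h.2, fun h => ⟨hm (mem_range.2 h), h⟩⟩
    rw [prod_ite, prod_const, prod_const_one, this, card_range, mul_one]
  rw [eval_prod, hpow, ← prod_mul_distrib]
  refine prod_pos fun i hi => ?_
  simp only [eval_add, eval_X, eval_C]
  split_ifs with h
  · linarith [hlt i hi h]
  · linarith [hgt i hi (not_lt.1 h)]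

lemma exists_eval_neg_eq_zero {P : ℝ[X]} {a b : ℝ} (hab : a < b) (i : ℕ)
    (ha : 0 < (-1) ^ i * P.eval (-a)) (hb : 0 < (-1) ^ (i + 1) * P.eval (-b)) :
    ∃ r, (a < r ∧ r < b) ∧ P.eval (-r) = 0 := by
  have hcont : Continuous fun t : ℝ => (-1) ^ i * P.eval (-t) := by fun_prop
  have hb' : (-1) ^ i * P.eval (-b) < 0 := by
    rw [pow_succ] at hb
    linarith
  obtain ⟨r, hr, h0⟩ := intermediate_value_Ioo' hab.le hcont.continuousOn ⟨hb', ha⟩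
  exact ⟨r, hr, (mul_eq_zero.1 h0).resolve_left (pow_ne_zero _ (by norm_num))⟩

lemma StrictMono.exists_modify_succ {v : ℕ → ℝ} (hv : StrictMono v) (e : ℕ) {p : ℝ → Prop}
    (hp : ∀ᶠ t in Filter.atTop, p t) :
    ∃ w : ℕ → ℝ, StrictMono w ∧ (∀ j ≤ e, w j = v j) ∧ p (w (e + 1)) := by
  obtain ⟨W, hW, hWv⟩ := (hp.and (Filter.eventually_gt_atTop (v e))).exists
  refine ⟨fun j => if j ≤ e then v j else W + ((j : ℝ) - (e + 1)), ?_, ?_, ?_⟩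
  · refine strictMono_nat_of_lt_succ fun j => ?_
    rcases lt_trichotomy j e with h | rfl | h
    · simp only [h.le, Nat.succ_le_of_lt h, if_true]
      exact hv j.lt_succ_self
    · simpa using hWv
    · simp only [not_le.2 h, not_le.2 (h.trans j.lt_succ_self), if_false]
      push_cast
      linarith
  · intro j hj
    simp [hj]
  · simpa using hW

lemma StrictMono.exists_between_consecutive {v : ℕ → ℝ} (hv : StrictMono v) (h0 : v 0 = 0)
    (e : ℕ) {q : ℕ → ℝ → Prop} (hq : ∀ j ≤ e, ∃ r, (v j < r ∧ r < v (j + 1)) ∧ q j r) :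
    ∃ w : ℕ → ℝ, w 0 = 0 ∧ StrictMono w ∧ ∀ j ≤ e, q j (w (j + 1)) := by
  have hq' (j : ℕ) : ∃ r, (v j < r ∧ r < v (j + 1)) ∧ (j ≤ e → q j r) := by
    by_cases hj : j ≤ e
    · obtain ⟨r, hr, hqr⟩ := hq j hj
      exact ⟨r, hr, fun _ => hqr⟩
    · obtain ⟨r, hr⟩ := exists_between (hv j.lt_succ_self)
      exact ⟨r, hr, fun h => absurd h hj⟩
  choose r hr hqr using hq'
  refine ⟨fun j => Nat.casesOn j 0 r, rfl, strictMono_nat_of_lt_succ fun j => ?_, hqr⟩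
  rcases j with _ | j
  · exact h0 ▸ (hr 0).1
  · exact (hr j).2.trans (hr (j + 1)).1

lemma coeff_eulerianPoly_succ_succ (n N : ℕ) :
    (eulerianPoly (n + 1)).coeff (N + 1) =
      (N + 2) * (eulerianPoly n).coeff (N + 1) + (n + 1 - N) * (eulerianPoly n).coeff N := by
  set A := eulerianPoly n with hA
  have : eulerianPoly (n + 1) =
      A + C ((n : ℝ) + 1) * (X * A) + X * derivative A - X * (X * derivative A) := by
    rw [eulerianPoly, ← hA]
    simp only [map_add, map_natCast, map_one]
    ring
  have hX : (X * derivative A).coeff N = N * A.coeff N := by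
    rcases N with _ | N
    · simp
    · rw [coeff_X_mul, coeff_derivative]
      push_cast
      ring
  rw [this, coeff_sub, coeff_add, coeff_add, coeff_C_mul, coeff_X_mul, coeff_X_mul, coeff_X_mul,
    hX, coeff_derivative]
  ring

lemma exists_eulerianPoly_eq_prod (n : ℕ) :
    ∃ v : ℕ → ℝ, v 0 = 0 ∧ StrictMono v ∧ ∃ a > 0,
      eulerianPoly n = C a * ∏ i ∈ range n, (X + C (v (i + 1))) := by
  induction n with
  | zero => exact ⟨fun n => n, by simp, Nat.strictMono_cast, 1, one_pos, by simp [eulerianPoly]⟩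
  | succ n ih =>
    obtain ⟨v, h0, hv, a, ha, hA⟩ := ih
    have hAdeg : (eulerianPoly n).natDegree ≤ n := hA ▸ natDegree_C_mul_prod_X_add_C_le _ _ _
    have hAcoeff : (eulerianPoly n).coeff n = a := hA ▸ coeff_C_mul_prod_X_add_C _ _ _
    have hdeg : (eulerianPoly (n + 1)).natDegree ≤ n + 1 := by
      refine natDegree_le_iff_coeff_eq_zero.2 fun N hN => ?_
      obtain ⟨N, rfl⟩ : ∃ M, N = M + 1 := ⟨N - 1, by omega⟩
      rw [coeff_eulerianPoly_succ_succ, coeff_eq_zero_of_natDegree_lt (by omega),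
        coeff_eq_zero_of_natDegree_lt (by omega)]
      ring
    have hcoeff : 0 < (eulerianPoly (n + 1)).coeff (n + 1) := by
      rw [coeff_eulerianPoly_succ_succ, hAcoeff, coeff_eq_zero_of_natDegree_lt (by omega)]
      linarith
    have hsign (j : ℕ) (hj : j ≤ n) : 0 < (-1) ^ j * (eulerianPoly (n + 1)).eval (-v j) := by
      rcases j with _ | j
      · have h := neg_one_pow_mul_eval_prod_pos (s := range n) (r := fun i => v (i + 1))
          (t := v 0) (m := 0) (by simp) (by simp) fun i _ _ => hv i.succ_pos
        rw [eulerianPoly, h0] at *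
        simp only [hA, neg_zero, pow_zero, one_mul, eval_add, eval_mul, eval_C, eval_X,
          eval_one, zero_mul, mul_zero, add_zero] at h ⊢
        exact mul_pos ha h
      · have hmem : j ∈ range n := mem_range.2 hj
        have h := neg_one_pow_mul_eval_prod_pos (s := (range n).erase j)
          (r := fun i => v (i + 1)) (t := v (j + 1)) (m := j)
          (fun i hi => by simp only [mem_erase, mem_range] at hi ⊢; omega)
          (fun i _ hi => hv (by omega))
          (fun i hi hji => hv (by have := (mem_erase.1 hi).1; omega))
        have hpos : 0 < v (j + 1) := h0 ▸ hv j.succ_pos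
        set Q := ∏ i ∈ (range n).erase j, (X + C (v (i + 1))) with hQ
        have hfac : eulerianPoly n = C a * ((X + C (v (j + 1))) * Q) := by
          rw [hA, hQ, mul_prod_erase _ (fun i => X + C (v (i + 1))) hmem]
        have heval : (-1) ^ (j + 1) * (eulerianPoly (n + 1)).eval (-v (j + 1)) =
            a * v (j + 1) * (1 + v (j + 1)) * ((-1) ^ j * Q.eval (-v (j + 1))) := by
          rw [eulerianPoly, hfac]
          simp only [derivative_mul, derivative_add, derivative_C, derivative_X, eval_add,
            eval_mul, eval_C, eval_X, eval_one, eval_sub, eval_zero, pow_succ]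
          ring
        rw [heval]
        positivity
    obtain ⟨w, hw, hwv, hwn⟩ :=
      hv.exists_modify_succ n (eventually_neg_one_pow_mul_eval_neg_pos hdeg hcoeff)
    have hsign' (j : ℕ) (hj : j ≤ n + 1) :
        0 < (-1) ^ j * (eulerianPoly (n + 1)).eval (-w j) := by
      rcases hj.lt_or_eq with h | rfl
      · rw [hwv j (by omega)]
        exact hsign j (by omega)
      · exact hwn
    obtain ⟨u, hu0, hu, hroot⟩ := hw.exists_between_consecutive (by rw [hwv 0 n.zero_le, h0]) n
      (q := fun _ r => (eulerianPoly (n + 1)).eval (-r) = 0) fun j hj =>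
        exists_eval_neg_eq_zero (hw j.lt_succ_self) j (hsign' j (by omega))
          (hsign' (j + 1) (by omega))
    exact ⟨u, hu0, hu, _, hcoeff, eq_C_mul_prod_X_add_C hdeg hcoeff
      (hu.injective.comp (add_left_injective 1)) fun i hi => hroot i (by omega)⟩

/-- `E` and `O` have only real negative simple zeros, `e` of them in total, which strictly
alternate, the largest one belonging to `E`; both leading coefficients are positive. -/
def StrictlyAlternating (e : ℕ) (E O : ℝ[X]) : Prop :=
  ∃ v : ℕ → ℝ, v 0 = 0 ∧ StrictMono v ∧ ∃ a > 0, ∃ b > 0,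
    E = C a * ∏ i ∈ range ((e + 1) / 2), (X + C (v (2 * i + 1))) ∧
    O = C b * ∏ i ∈ range (e / 2), (X + C (v (2 * i + 2)))

lemma coeff_nonneg_of_le {P : ℝ[X]} {m k : ℕ} (hdeg : P.natDegree ≤ m) (hc : 0 < P.coeff m)
    (hmk : m ≤ k) : 0 ≤ P.coeff k := by
  rcases hmk.lt_or_eq with h | rfl
  · rw [coeff_eq_zero_of_natDegree_lt (by omega)]
  · exact hc.le

lemma StrictlyAlternating.mul_X_add_C {e : ℕ} {E O : ℝ[X]} (h : StrictlyAlternating e E O)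
    {c : ℝ} (hc : 0 < c) :
    StrictlyAlternating (e + 1) (C c * E + X * O) (C c * O + E) := by
  obtain ⟨v, h0, hv, a, ha, b, hb, hE, hO⟩ := h
  have hEdeg : E.natDegree ≤ (e + 1) / 2 := hE ▸ natDegree_C_mul_prod_X_add_C_le _ _ _
  have hOdeg : O.natDegree ≤ e / 2 := hO ▸ natDegree_C_mul_prod_X_add_C_le _ _ _
  have hEcoeff : E.coeff ((e + 1) / 2) = a := hE ▸ coeff_C_mul_prod_X_add_C _ _ _
  have hOcoeff : O.coeff (e / 2) = b := hO ▸ coeff_C_mul_prod_X_add_C _ _ _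
  have hEsign (i : ℕ) (hi : 2 * i ≤ e) : 0 < (-1) ^ i * E.eval (-v (2 * i)) := by
    have h := neg_one_pow_mul_eval_prod_pos (s := range ((e + 1) / 2))
      (r := fun i => v (2 * i + 1)) (t := v (2 * i)) (m := i)
      (range_subset_range.2 (by omega)) (fun j _ _ => hv (by omega)) (fun j _ _ => hv (by omega))
    rw [hE, eval_mul, eval_C, mul_left_comm]
    exact mul_pos ha h
  have hOsign (i : ℕ) (hi : 2 * i + 1 ≤ e) : 0 < (-1) ^ i * O.eval (-v (2 * i + 1)) := by
    have h := neg_one_pow_mul_eval_prod_pos (s := range (e / 2))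
      (r := fun i => v (2 * i + 2)) (t := v (2 * i + 1)) (m := i)
      (range_subset_range.2 (by omega)) (fun j _ _ => hv (by omega)) (fun j _ _ => hv (by omega))
    rw [hO, eval_mul, eval_C, mul_left_comm]
    exact mul_pos hb h
  have hEroot (i : ℕ) (hi : 2 * i + 1 ≤ e) : E.eval (-v (2 * i + 1)) = 0 := by
    rw [hE, eval_mul, eval_prod, prod_eq_zero (i := i) (mem_range.2 (by omega)) (by simp),
      mul_zero]
  have hOroot (i : ℕ) (hi : 2 * i + 2 ≤ e) : O.eval (-v (2 * i + 2)) = 0 := by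
    rw [hO, eval_mul, eval_prod, prod_eq_zero (i := i) (mem_range.2 (by omega)) (by simp),
      mul_zero]
  set F := C c * E + X * O with hF
  set G := C c * O + E with hG
  have hFdeg : F.natDegree ≤ (e + 1 + 1) / 2 := by
    refine natDegree_add_le_of_degree_le ((natDegree_C_mul_le _ _).trans (by omega)) ?_
    refine natDegree_mul_le.trans ?_
    rw [natDegree_X]
    omega
  have hGdeg : G.natDegree ≤ (e + 1) / 2 :=
    natDegree_add_le_of_degree_le ((natDegree_C_mul_le _ _).trans (by omega)) hEdeg
  have hFcoeff : 0 < F.coeff ((e + 1 + 1) / 2) := by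
    have h1 := coeff_nonneg_of_le hEdeg (hEcoeff ▸ ha) (k := e / 2 + 1) (by omega)
    rw [show (e + 1 + 1) / 2 = e / 2 + 1 by omega, hF, coeff_add, coeff_C_mul, coeff_X_mul,
      hOcoeff]
    positivity
  have hGcoeff : 0 < G.coeff ((e + 1) / 2) := by
    have h1 := coeff_nonneg_of_le hOdeg (hOcoeff ▸ hb) (k := (e + 1) / 2) (by omega)
    rw [hG, coeff_add, coeff_C_mul, hEcoeff]
    positivity
  have hFsign_even (i : ℕ) (hi : 2 * i ≤ e) : 0 < (-1) ^ i * F.eval (-v (2 * i)) := by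
    have h := mul_pos hc (hEsign i hi)
    have hz : v (2 * i) * O.eval (-v (2 * i)) = 0 := by
      rcases i with _ | i
      · simp [h0]
      · rw [show 2 * (i + 1) = 2 * i + 2 by ring, hOroot i (by omega), mul_zero]
    rw [hF]
    simp only [eval_add, eval_mul, eval_C, eval_X]
    linear_combination h + (-1) ^ i * hz
  have hFsign_odd (i : ℕ) (hi : 2 * i + 1 ≤ e) :
      0 < (-1) ^ (i + 1) * F.eval (-v (2 * i + 1)) := by
    have h := mul_pos (h0 ▸ hv (Nat.succ_pos (2 * i)) : 0 < v (2 * i + 1)) (hOsign i hi)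
    rw [hF]
    simp only [eval_add, eval_mul, eval_C, eval_X, hEroot i hi, pow_succ]
    linear_combination h
  have hGsign_odd (i : ℕ) (hi : 2 * i + 1 ≤ e) :
      0 < (-1) ^ i * G.eval (-v (2 * i + 1)) := by
    have h := mul_pos hc (hOsign i hi)
    rw [hG]
    simp only [eval_add, eval_mul, eval_C, hEroot i hi]
    linear_combination h
  have hGsign_even (i : ℕ) (hi : 2 * i + 2 ≤ e) :
      0 < (-1) ^ (i + 1) * G.eval (-v (2 * i + 2)) := by
    have h := hEsign (i + 1) (by omega)
    rw [hG]
    simp only [eval_add, eval_mul, eval_C, hOroot i hi]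
    linear_combination h
  obtain ⟨w, hw, hwv, hwF, hwG⟩ := hv.exists_modify_succ e
    ((eventually_neg_one_pow_mul_eval_neg_pos hFdeg hFcoeff).and
      (eventually_neg_one_pow_mul_eval_neg_pos hGdeg hGcoeff))
  obtain ⟨u, hu0, hu, hroot⟩ := hw.exists_between_consecutive (by rw [hwv 0 e.zero_le, h0]) e
    (q := fun j r => (Even j → F.eval (-r) = 0) ∧ (Odd j → G.eval (-r) = 0)) fun j hj => by
      rcases j.even_or_odd' with ⟨i, rfl | rfl⟩
      · have hend : 0 < (-1) ^ (i + 1) * F.eval (-w (2 * i + 1)) := by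
          rcases hj.lt_or_eq with h | h
          · rw [hwv _ h]
            exact hFsign_odd i h
          · rwa [← h, show (2 * i + 1 + 1) / 2 = i + 1 by omega] at hwF
        obtain ⟨r, hr, hr0⟩ := exists_eval_neg_eq_zero (hw (2 * i).lt_succ_self) i
          (by rw [hwv _ hj]; exact hFsign_even i hj) hend
        exact ⟨r, hr, fun _ => hr0, fun h => absurd h (by simp)⟩
      · have hend : 0 < (-1) ^ (i + 1) * G.eval (-w (2 * i + 2)) := by
          rcases hj.lt_or_eq with h | h
          · rw [hwv _ h]
            exact hGsign_even i h
          · rwa [← h, show (2 * i + 1 + 1) / 2 = i + 1 by omega] at hwG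
        obtain ⟨r, hr, hr0⟩ := exists_eval_neg_eq_zero (hw (2 * i + 1).lt_succ_self) i
          (by rw [hwv _ hj]; exact hGsign_odd i hj) hend
        exact ⟨r, hr, fun h => absurd h (by simp), fun _ => hr0⟩
  refine ⟨u, hu0, hu, _, hFcoeff, _, hGcoeff, ?_, ?_⟩
  · refine eq_C_mul_prod_X_add_C hFdeg hFcoeff (r := fun i => u (2 * i + 1))
      (fun i j hij => by have := hu.injective hij; omega) fun i hi => ?_
    exact (hroot (2 * i) (by omega)).1 (by simp)
  · refine eq_C_mul_prod_X_add_C hGdeg hGcoeff (r := fun i => u (2 * i + 2))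
      (fun i j hij => by have := hu.injective hij; omega) fun i hi => ?_
    exact (hroot (2 * i + 1) (by omega)).2 (by simp)

/-- The even and odd parts of `P` are strictly alternating, with `e` zeros in total. -/
def HasAlternatingParts (e : ℕ) (P : ℝ[X]) : Prop :=
  ∃ E O : ℝ[X], expand ℝ 2 E + X * expand ℝ 2 O = P ∧ StrictlyAlternating e E O

lemma HasAlternatingParts.mul_X_add_C {e : ℕ} {P : ℝ[X]} (h : HasAlternatingParts e P) {c : ℝ}
    (hc : 0 < c) : HasAlternatingParts (e + 1) (P * (X + C c)) := by
  obtain ⟨E, O, rfl, hEO⟩ := h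
  refine ⟨_, _, ?_, hEO.mul_X_add_C hc⟩
  simp only [map_add, map_mul, expand_C, expand_X]
  ring

lemma HasAlternatingParts.mul_prod_X_add_C {e : ℕ} {P : ℝ[X]} (h : HasAlternatingParts e P)
    (n : ℕ) {r : ℕ → ℝ} (hr : ∀ i, 0 < r i) :
    HasAlternatingParts (e + n) (P * ∏ i ∈ range n, (X + C (r i))) := by
  induction n with
  | zero => simpa using h
  | succ n ih =>
    rw [prod_range_succ, ← mul_assoc, ← add_assoc]
    exact ih.mul_X_add_C (hr n)

lemma hasAlternatingParts_C_mul_X_add_one {a : ℝ} (ha : 0 < a) :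
    HasAlternatingParts 0 (C a * (X + 1)) := by
  refine ⟨C a, C a, by simp only [expand_C]; ring, fun n => n, by simp, Nat.strictMono_cast,
    a, ha, a, ha, by simp, by simp⟩

lemma strictlyAlternating_CEpoly_COpoly (n : ℕ) :
    StrictlyAlternating (2 * n) (CEpoly (n + 1)) (COpoly (n + 1)) := by
  obtain ⟨v, h0, hv, a, ha, hA⟩ := exists_eulerianPoly_eq_prod n
  have h := ((hasAlternatingParts_C_mul_X_add_one ha).mul_prod_X_add_C n
    (fun _ => one_pos)).mul_prod_X_add_C n (fun i => h0 ▸ hv i.succ_pos)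
  obtain ⟨E, O, hEO, hs⟩ := h
  have : expand ℝ 2 E + X * expand ℝ 2 O =
      expand ℝ 2 (CEpoly (n + 1)) + X * expand ℝ 2 (COpoly (n + 1)) := by
    rw [hEO, expand_CEpoly_add_expand_COpoly, hA, prod_const, card_range, map_one]
    ring
  obtain ⟨rfl, rfl⟩ := expand_two_add_X_mul_injective this
  rwa [zero_add, ← two_mul] at hs

/-- For every `n ≥ 2`, both `C_n^E(x)` and `C_n^O(x)` have only real negative
zeros (they factor completely into `n-1` linear factors over `ℝ` with negative
roots), and the zeros `ξ_1 ≤ … ≤ ξ_{n-1}` of `C_n^O` and `θ_1 ≤ … ≤ θ_{n-1}` of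
`C_n^E` alternate: `ξ_1 ≤ θ_1 ≤ ξ_2 ≤ θ_2 ≤ … ≤ ξ_{n-1} ≤ θ_{n-1}`,
i.e. `C_n^O(x) ≺ C_n^E(x)`. -/
theorem CO_alternates_left_of_CE (n : ℕ) (hn : 2 ≤ n) :
    ∃ ξ θ : ℕ → ℝ,
      (∀ i, i < n - 1 → ξ i < 0) ∧
      (∀ i, i < n - 1 → θ i < 0) ∧
      (∀ i, i + 1 < n - 1 → ξ i ≤ ξ (i + 1)) ∧
      (∀ i, i + 1 < n - 1 → θ i ≤ θ (i + 1)) ∧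
      (∀ i, i < n - 1 → ξ i ≤ θ i) ∧
      (∀ i, i + 1 < n - 1 → θ i ≤ ξ (i + 1)) ∧
      COpoly n =
        Polynomial.C (COpoly n).leadingCoeff *
          ∏ i ∈ Finset.range (n - 1), (X - Polynomial.C (ξ i)) ∧
      CEpoly n =
        Polynomial.C (CEpoly n).leadingCoeff *
          ∏ i ∈ Finset.range (n - 1), (X - Polynomial.C (θ i)) := by
  obtain ⟨n, rfl⟩ : ∃ m, n = m + 1 := ⟨n - 1, by omega⟩
  obtain ⟨v, h0, hv, a, -, b, -, hE, hO⟩ := strictlyAlternating_CEpoly_COpoly n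
  rw [show (2 * n + 1) / 2 = n by omega] at hE
  rw [show 2 * n / 2 = n by omega] at hO
  have hlE : (CEpoly (n + 1)).leadingCoeff = a := hE ▸ leadingCoeff_C_mul_prod_X_add_C _ _ _
  have hlO : (COpoly (n + 1)).leadingCoeff = b := hO ▸ leadingCoeff_C_mul_prod_X_add_C _ _ _
  have hpos (j : ℕ) : 0 < v (j + 1) := h0 ▸ hv j.succ_pos
  simp only [Nat.add_sub_cancel]
  refine ⟨fun i => -v (2 * (n - 1 - i) + 2), fun i => -v (2 * (n - 1 - i) + 1),
    fun i _ => neg_lt_zero.2 (hpos _), fun i _ => neg_lt_zero.2 (hpos _),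
    fun i hi => neg_le_neg (hv.monotone (by omega)),
    fun i hi => neg_le_neg (hv.monotone (by omega)),
    fun i hi => neg_le_neg (hv.monotone (by omega)),
    fun i hi => neg_le_neg (hv.monotone (by omega)), ?_, ?_⟩
  · rw [hlO, prod_range_reflect (fun j => X - C (-v (2 * j + 2))) n]
    simpa only [map_neg, sub_neg_eq_add] using hO
  · rw [hlE, prod_range_reflect (fun j => X - C (-v (2 * j + 1))) n]
    simpa only [map_neg, sub_neg_eq_add] using hE
end

section
/- For every n ≥ 0, 2^n·A_n(x) = Σ_{k=0}^{n} binom(n,k)·A_k(x)·C_{n−k}^E(x), where C_0^E(x) := 1. -/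
open Polynomial Finset

/-- The value `π(i)` of a permutation of `[n]` at position `i ∈ [n]`
(1-indexed), with `π(0) = 0`. -/
def pval (n : ℕ) (π : Equiv.Perm (Fin n)) (i : ℕ) : ℤ :=
  if h : 1 ≤ i ∧ i ≤ n then ((π ⟨i - 1, by omega⟩ : Fin n).val + 1 : ℤ) else 0

/-- The descent number of a permutation of `[n]`. -/
def desS (n : ℕ) (π : Equiv.Perm (Fin n)) : ℕ :=
  ((Finset.Icc 1 (n - 1)).filter (fun i => pval n π (i + 1) < pval n π i)).card

/-- The Eulerian polynomial `A_n(x) = Σ_{π ∈ S_n} x^{des(π)}`. -/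
noncomputable def Apoly (n : ℕ) : Polynomial ℝ :=
  ∑ π : Equiv.Perm (Fin n), X ^ desS n π

/-- `C_n^E(x)` with the convention `C_0^E(x) := 1`. -/
noncomputable def CEpoly' (n : ℕ) : Polynomial ℝ :=
  if n = 0 then 1 else CEpoly n

/-- The number of descents of a word `f` of length `n`. -/
def wordDes {n : ℕ} (f : Fin n → ℤ) : ℕ :=
  ((Finset.Icc 1 (n - 1)).filter (fun i =>
    (if h : 1 ≤ i + 1 ∧ i + 1 ≤ n then f ⟨i + 1 - 1, by omega⟩ else 0) <
      if h : 1 ≤ i ∧ i ≤ n then f ⟨i - 1, by omega⟩ else 0)).card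

/-- The integer with sign determined by `b` (`true` meaning negative) and absolute value `v + 1`. -/
def signedVal (b : Bool) (v : ℕ) : ℤ := (if b then -1 else 1) * (v + 1)

lemma signedVal_lt_iff {b c : Bool} {u v u' v' : ℕ} (h : u < v ↔ u' < v') (h' : v < u ↔ v' < u') :
    signedVal b u < signedVal c v ↔ signedVal b u' < signedVal c v' := by
  cases b <;> cases c <;> simp [signedVal] <;> omega

lemma signedVal_inj {b c : Bool} {u v : ℕ} (h : signedVal b u = signedVal c v) : u = v := by
  cases b <;> cases c <;> simp [signedVal] at h <;> omega

lemma desA_eq_wordDes {n : ℕ} (π : SPerm n) :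
    desA n π = wordDes fun i => signedVal (π.2 i) (π.1 i) := rfl

lemma desS_eq_wordDes {n : ℕ} (π : Equiv.Perm (Fin n)) :
    desS n π = wordDes fun i => ((π i : ℕ) + 1 : ℤ) := rfl

lemma wordDes_congr {n : ℕ} {f g : Fin n → ℤ} (h : ∀ i j, f i < f j ↔ g i < g j) :
    wordDes f = wordDes g := by
  unfold wordDes
  congr 1
  refine Finset.filter_congr fun i hi => ?_
  rw [Finset.mem_Icc] at hi
  rw [dif_pos (by omega), dif_pos (by omega), dif_pos (by omega), dif_pos (by omega)]
  exact h _ _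

lemma wordDes_eq_card {n : ℕ} (f : Fin n → ℤ) :
    wordDes f = ((Finset.range (n - 1)).filter fun i =>
      ∃ h : i + 1 < n, f ⟨i + 1, h⟩ < f ⟨i, by omega⟩).card := by
  unfold wordDes
  symm
  refine Finset.card_bij (fun i _ => i + 1) ?_ (by simp) ?_
  · intro i hi
    simp only [Finset.mem_filter, Finset.mem_range, Finset.mem_Icc] at hi ⊢
    obtain ⟨hi, h, hlt⟩ := hi
    refine ⟨by omega, ?_⟩
    rw [dif_pos (by omega), dif_pos (by omega)]
    exact hlt
  · intro i hi
    simp only [Finset.mem_filter, Finset.mem_range, Finset.mem_Icc] at hi ⊢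
    obtain ⟨hi, hlt⟩ := hi
    obtain ⟨i, rfl⟩ : ∃ j, i = j + 1 := ⟨i - 1, by omega⟩
    rw [dif_pos (by omega), dif_pos (by omega)] at hlt
    exact ⟨i, ⟨by omega, by omega, hlt⟩, rfl⟩

/-- Descents are additive under concatenation of two words with no descent at the junction. -/
lemma wordDes_append {k m : ℕ} (f : Fin (k + m) → ℤ)
    (h : ∀ (i : Fin k) (j : Fin m), j.val = 0 → f (Fin.castAdd m i) < f (Fin.natAdd k j)) :
    wordDes f = wordDes (fun i => f (Fin.castAdd m i)) + wordDes (fun j => f (Fin.natAdd k j)) := by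
  simp only [wordDes_eq_card]
  rw [← Finset.card_map (addLeftEmbedding k)
    (s := (Finset.range (m - 1)).filter _), ← Finset.card_union_of_disjoint]
  · congr 1
    ext i
    simp only [Finset.mem_filter, Finset.mem_range, Finset.mem_union, Finset.mem_map,
      addLeftEmbedding_apply]
    constructor
    · rintro ⟨h1, h2, h3⟩
      rcases lt_trichotomy (i + 1) k with hk | hk | hk
      · exact Or.inl ⟨by omega, hk, h3⟩
      · have := h ⟨i, by omega⟩ ⟨0, by omega⟩ rfl
        simp only [Fin.castAdd_mk, Fin.natAdd_mk, add_zero, ← hk] at this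
        exact absurd h3 this.not_gt
      · obtain ⟨j, rfl⟩ : ∃ j, i = k + j := ⟨i - k, by omega⟩
        exact Or.inr ⟨j, ⟨by omega, by omega, h3⟩, rfl⟩
    · rintro (⟨h1, h2, h3⟩ | ⟨j, ⟨h1, h2, h3⟩, rfl⟩)
      · exact ⟨by omega, by omega, h3⟩
      · exact ⟨by omega, by omega, h3⟩
  · rw [Finset.disjoint_left]
    intro i hi hj
    simp only [Finset.mem_filter, Finset.mem_range, Finset.mem_map,
      addLeftEmbedding_apply] at hi hj
    obtain ⟨j, -, rfl⟩ := hj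
    omega

/-- The rearrangements of a word with distinct letters have Eulerian descent distribution. -/
lemma sum_wordDes_comp_perm {n : ℕ} {g : Fin n → ℤ} (hg : Function.Injective g) :
    ∑ σ : Equiv.Perm (Fin n), (X : ℝ[X]) ^ wordDes (fun i => g (σ i)) = Apoly n := by
  rw [Apoly, ← Equiv.sum_comp (Equiv.mulLeft (Tuple.sort g))]
  refine Finset.sum_congr rfl fun σ _ => ?_
  have hmono : StrictMono (g ∘ Tuple.sort g) :=
    (Tuple.monotone_sort g).strictMono_of_injective (hg.comp (Tuple.sort g).injective)
  rw [desS_eq_wordDes]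
  congr 1
  refine wordDes_congr fun i j => ?_
  have : g (Tuple.sort g (σ i)) < g (Tuple.sort g (σ j)) ↔ σ i < σ j := hmono.lt_iff_lt
  simpa using this

lemma card_compl_of_card {k m : ℕ} {S : Finset (Fin (k + m))} (hS : S.card = k) :
    Sᶜ.card = m := by
  rw [Finset.card_compl, hS, Fintype.card_fin, Nat.add_sub_cancel_left]

/-- The permutation of `Fin (k + m)` whose first `k` values form `S`, arranged according to `σ`,
and whose last `m` values are arranged according to `τ`. -/
def shuffle {k m : ℕ} (p : {S : Finset (Fin (k + m)) // S.card = k} ×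
    Equiv.Perm (Fin k) × Equiv.Perm (Fin m)) : Equiv.Perm (Fin (k + m)) :=
  finSumFinEquiv.symm.trans ((Equiv.sumCongr p.2.1 p.2.2).trans
    (finSumEquivOfFinset p.1.2 (card_compl_of_card p.1.2)))

lemma shuffle_castAdd {k m : ℕ} (p : {S : Finset (Fin (k + m)) // S.card = k} ×
    Equiv.Perm (Fin k) × Equiv.Perm (Fin m)) (i : Fin k) :
    shuffle p (Fin.castAdd m i) = p.1.1.orderEmbOfFin p.1.2 (p.2.1 i) := by
  simp [shuffle]

lemma shuffle_natAdd {k m : ℕ} (p : {S : Finset (Fin (k + m)) // S.card = k} ×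
    Equiv.Perm (Fin k) × Equiv.Perm (Fin m)) (j : Fin m) :
    shuffle p (Fin.natAdd k j) =
      p.1.1ᶜ.orderEmbOfFin (card_compl_of_card p.1.2) (p.2.2 j) := by
  simp [shuffle]

lemma shuffle_injective {k m : ℕ} : Function.Injective (@shuffle k m) := by
  intro p q h
  have image_eq (p : {S : Finset (Fin (k + m)) // S.card = k} ×
      Equiv.Perm (Fin k) × Equiv.Perm (Fin m)) :
      Set.range (fun i => shuffle p (Fin.castAdd m i)) = p.1.1 := by
    simp only [shuffle_castAdd]
    rw [← Finset.range_orderEmbOfFin p.1.1 p.1.2]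
    exact p.2.1.surjective.range_comp (p.1.1.orderEmbOfFin p.1.2)
  have hS : p.1 = q.1 := by
    apply Subtype.ext
    rw [← Finset.coe_inj, ← image_eq p, ← image_eq q, h]
  obtain ⟨S, σ, τ⟩ := p
  obtain ⟨T, σ', τ'⟩ := q
  obtain rfl : S = T := hS
  have hσ : σ = σ' := by
    ext1 i
    have := congrArg (· (Fin.castAdd m i)) h
    simpa [shuffle_castAdd] using this
  have hτ : τ = τ' := by
    ext1 j
    have := congrArg (· (Fin.natAdd k j)) h
    simpa [shuffle_natAdd] using this
  rw [hσ, hτ]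

lemma shuffle_bijective {k m : ℕ} : Function.Bijective (@shuffle k m) := by
  rw [Fintype.bijective_iff_injective_and_card]
  refine ⟨shuffle_injective, ?_⟩
  simp only [Fintype.card_prod, Fintype.card_finset_len, Fintype.card_perm, Fintype.card_fin]
  rw [← mul_assoc, Nat.choose_symm_add, Nat.add_choose_mul_factorial_mul_factorial]

/-- The condition that a sign vector does not start with a negative sign. -/
def StartsPos {m : ℕ} (δ : Fin m → Bool) : Prop := ∀ i, i.val = 0 → δ i = false

instance {m : ℕ} : DecidablePred (@StartsPos m) := fun _ => inferInstanceAs (Decidable (∀ _, _))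

lemma CEpoly'_eq_sum (m : ℕ) :
    CEpoly' m = ∑ δ : Fin m → Bool with StartsPos δ, ∑ τ : Equiv.Perm (Fin m),
      (X : ℝ[X]) ^ wordDes fun i => signedVal (δ i) (τ i) := by
  rcases m with _ | m
  · simp [CEpoly', wordDes, StartsPos]
  · rw [CEpoly', if_neg (by omega), CEpoly, Finset.sum_filter, Fintype.sum_prod_type_right,
      Finset.sum_filter]
    refine Finset.sum_congr rfl fun δ _ => ?_
    have key (τ : Equiv.Perm (Fin (m + 1))) : 0 < sval (m + 1) (τ, δ) 1 ↔ StartsPos δ := by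
      have : StartsPos δ ↔ δ 0 = false :=
        ⟨fun h => h 0 rfl, fun h i hi => by rwa [show i = 0 from Fin.ext hi]⟩
      rw [this, sval, dif_pos (by omega)]
      change 0 < signedVal (δ 0) (τ 0) ↔ _
      cases δ 0 <;> simp [signedVal]
    simp only [key, desA_eq_wordDes]
    split_ifs <;> simp

/-- The length of the longest negative prefix of a sign vector. -/
def negPrefix {n : ℕ} (ε : Fin n → Bool) : ℕ :=
  Nat.find (p := fun k => ∀ i : Fin n, i.val = k → ε i = false)
    ⟨n, fun i hi => absurd i.2 (by omega)⟩

lemma negPrefix_le {n : ℕ} (ε : Fin n → Bool) : negPrefix ε ≤ n :=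
  Nat.find_min' _ fun i hi => absurd i.2 (by omega)

lemma negPrefix_eq_iff {k m : ℕ} (ε : Fin (k + m) → Bool) :
    negPrefix ε = k ↔
      (∀ i : Fin k, ε (Fin.castAdd m i) = true) ∧ StartsPos fun j => ε (Fin.natAdd k j) := by
  rw [negPrefix, Nat.find_eq_iff, and_comm]
  refine and_congr ⟨fun h i => ?_, fun h l hl h' => ?_⟩ ⟨fun h j hj => ?_, fun h i hi => ?_⟩
  · by_contra hi
    refine h i i.2 fun j hj => ?_
    rw [show j = Fin.castAdd m i from Fin.ext hj]
    simpa using hi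
  · have := h' (Fin.castAdd m ⟨l, hl⟩) rfl
    rw [h] at this
    cases this
  · exact h _ (by simp [hj])
  · have hm : 0 < m := by have := i.2; omega
    rw [show i = Fin.natAdd k ⟨0, hm⟩ from Fin.ext (by simp [hi])]
    exact h _ rfl

lemma sum_negPrefix_eq {k m : ℕ} (F : (Fin (k + m) → Bool) → ℝ[X]) :
    ∑ ε : Fin (k + m) → Bool with negPrefix ε = k, F ε =
      ∑ δ : Fin m → Bool with StartsPos δ, F (Fin.append (fun _ => true) δ) := by
  symm
  refine Finset.sum_bij' (fun δ _ => Fin.append (fun _ => true) δ)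
    (fun ε _ j => ε (Fin.natAdd k j)) ?_ ?_ ?_ ?_ ?_
  · intro δ hδ
    simpa [negPrefix_eq_iff] using hδ
  · intro ε hε
    simp only [Finset.mem_filter, Finset.mem_univ, true_and, negPrefix_eq_iff] at hε ⊢
    exact hε.2
  · intro δ _
    simp
  · intro ε hε
    simp only [Finset.mem_filter, Finset.mem_univ, true_and, negPrefix_eq_iff] at hε
    funext i
    induction i using Fin.addCases with
    | left i => simp [hε.1]
    | right j => simp
  · intros
    rfl

lemma wordDes_shuffle {k m : ℕ} (p : {S : Finset (Fin (k + m)) // S.card = k} ×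
    Equiv.Perm (Fin k) × Equiv.Perm (Fin m)) (δ : Fin m → Bool) (hδ : StartsPos δ) :
    wordDes (fun i => signedVal (Fin.append (fun _ : Fin k => true) δ i) (shuffle p i)) =
      wordDes (fun i => signedVal true (p.1.1.orderEmbOfFin p.1.2 (p.2.1 i))) +
        wordDes (fun j => signedVal (δ j) (p.2.2 j)) := by
  rw [wordDes_append]
  · simp only [Fin.append_left, Fin.append_right, shuffle_castAdd, shuffle_natAdd]
    congr 1
    refine wordDes_congr fun i j => signedVal_lt_iff ?_ ?_ <;>
      exact (p.1.1ᶜ.orderEmbOfFin (card_compl_of_card p.1.2)).lt_iff_lt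
  · intro i j hj
    simp only [Fin.append_left, Fin.append_right, hδ j hj, signedVal]
    simp only [if_true, Bool.false_eq_true, if_false]
    omega

/-- The sum of `x ^ des_A` over all signed permutations is `2 ^ n * A_n`. -/
lemma sum_signedPerm (n : ℕ) :
    ∑ ε : Fin n → Bool, ∑ σ : Equiv.Perm (Fin n),
      (X : ℝ[X]) ^ wordDes (fun i => signedVal (ε i) (σ i)) = 2 ^ n * Apoly n := by
  rw [Finset.sum_comm]
  have (σ : Equiv.Perm (Fin n)) :
      ∑ ε : Fin n → Bool, (X : ℝ[X]) ^ wordDes (fun i => signedVal (ε i) (σ i)) =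
        ∑ η : Fin n → Bool, (X : ℝ[X]) ^ wordDes (fun i => signedVal (η (σ i)) (σ i)) :=
    (Equiv.sum_comp (σ.symm.arrowCongr (Equiv.refl Bool))
      fun ε => (X : ℝ[X]) ^ wordDes (fun i => signedVal (ε i) (σ i))).symm
  simp only [this]
  rw [Finset.sum_comm]
  have h (η : Fin n → Bool) : Function.Injective fun v : Fin n => signedVal (η v) v :=
    fun u v huv => Fin.ext (signedVal_inj huv)
  simp only [fun η => sum_wordDes_comp_perm (h η)]
  simp

/-- For every `n ≥ 0`,
`2^n · A_n(x) = Σ_{k=0}^{n} binom(n,k) · A_k(x) · C_{n-k}^E(x)`. -/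
theorem two_pow_eulerian_convolution (n : ℕ) :
    (2 : Polynomial ℝ) ^ n * Apoly n =
      ∑ k ∈ Finset.range (n + 1),
        Polynomial.C ((n.choose k : ℝ)) * Apoly k * CEpoly' (n - k) := by
  rw [← sum_signedPerm, ← Finset.sum_fiberwise_of_maps_to (t := Finset.range (n + 1))
    (g := negPrefix) fun ε _ => Finset.mem_range.2 (Nat.lt_succ_of_le (negPrefix_le ε))]
  refine Finset.sum_congr rfl fun k hk => ?_
  obtain ⟨m, rfl⟩ := Nat.exists_eq_add_of_le (Finset.mem_range_succ_iff.1 hk)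
  rw [sum_negPrefix_eq, Nat.add_sub_cancel_left, CEpoly'_eq_sum, Finset.mul_sum]
  refine Finset.sum_congr rfl fun δ hδ => ?_
  rw [← shuffle_bijective.sum_comp, Fintype.sum_prod_type]
  have hinj (S : {S : Finset (Fin (k + m)) // S.card = k}) :
      Function.Injective fun v : Fin k => signedVal true (S.1.orderEmbOfFin S.2 v) :=
    fun u v huv => (S.1.orderEmbOfFin S.2).injective (Fin.ext (signedVal_inj huv))
  simp only [wordDes_shuffle _ δ (Finset.mem_filter.1 hδ).2, pow_add, Fintype.sum_prod_type]
  trans ∑ S : {S : Finset (Fin (k + m)) // S.card = k},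
    Apoly k * ∑ τ : Equiv.Perm (Fin m), X ^ wordDes fun j => signedVal (δ j) (τ j)
  · refine Finset.sum_congr rfl fun S _ => ?_
    rw [← sum_wordDes_comp_perm (hinj S), Finset.sum_mul_sum]
  · simp [mul_assoc]
end

section
/- For every n ≥ 1, the polynomials L_n^E(x) and L_n^O(x) satisfy the recurrence system L_{n+1}^E(x) = 2nx·L_n^E(x) + 2x(1−x)·(L_n^E)′(x) + x·L_n^O(x) and L_{n+1}^O(x) = ((2n−1)x+1)·L_n^O(x) + 2x(1−x)·(L_n^O)′(x) + L_n^E(x), with initial conditions L_1^E(x) = 0 and L_1^O(x) = 1. -/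
open Polynomial Finset

/-- A candidate Stirling permutation of order `n`: a word of length `2n` with
letters in `[n]` (encoded as `Fin n`). -/
abbrev StWord (n : ℕ) := Fin (2 * n) → Fin n

/-- The letter of a word at position `i ∈ [2n]` (1-indexed, values in `[n]`),
with the convention that the value is `0` outside `[1, 2n]` (so `σ_0 = 0`). -/
def qval (n : ℕ) (σ : StWord n) (i : ℕ) : ℕ :=
  if h : 1 ≤ i ∧ i ≤ 2 * n then (σ ⟨i - 1, by omega⟩ : Fin n).val + 1 else 0

/-- `σ` is a Stirling permutation: each letter of `[n]` occurs exactly twice,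
and all entries between the two occurrences of any letter are larger than it. -/
def IsStirling (n : ℕ) (σ : StWord n) : Prop :=
  (∀ k : Fin n, (Finset.univ.filter (fun i => σ i = k)).card = 2) ∧
  (∀ a b c : Fin (2 * n), a < b → b < c → σ a = σ c → σ a < σ b)

instance (n : ℕ) : DecidablePred (IsStirling n) := fun σ => by
  unfold IsStirling; infer_instance

/-- The ascent-plateau number `ap(σ) = #{i ∈ [2, 2n-1] : σ_{i-1} < σ_i = σ_{i+1}}`. -/
def ap (n : ℕ) (σ : StWord n) : ℕ :=
  ((Finset.Icc 2 (2 * n - 1)).filter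
    (fun i => qval n σ (i - 1) < qval n σ i ∧ qval n σ i = qval n σ (i + 1))).card

/-- The left ascent-plateau number
`lap(σ) = #{i ∈ [2n-1] : σ_{i-1} < σ_i = σ_{i+1}}` with `σ_0 = 0`. -/
def lap (n : ℕ) (σ : StWord n) : ℕ :=
  ((Finset.Icc 1 (2 * n - 1)).filter
    (fun i => qval n σ (i - 1) < qval n σ i ∧ qval n σ i = qval n σ (i + 1))).card

/-- `L_n^E(x) = Σ_{σ ∈ Q_n, σ_1 < σ_2} x^{ap(σ)}`. -/
noncomputable def LEpoly (n : ℕ) : Polynomial ℝ :=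
  ∑ σ ∈ Finset.univ.filter
      (fun σ : StWord n => IsStirling n σ ∧ qval n σ 1 < qval n σ 2),
    X ^ ap n σ

/-- `L_n^O(x) = Σ_{σ ∈ Q_n, σ_1 = σ_2} x^{ap(σ)}`. -/
noncomputable def LOpoly (n : ℕ) : Polynomial ℝ :=
  ∑ σ ∈ Finset.univ.filter
      (fun σ : StWord n => IsStirling n σ ∧ qval n σ 1 = qval n σ 2),
    X ^ ap n σ

/-- The order embedding of `[2n]` into `[2n + 2]` that skips the positions `j` and `j + 1`. -/
def skipPair (n j : ℕ) (i : Fin (2 * n)) : Fin (2 * (n + 1)) :=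
  if i.val < j then ⟨i.val, by omega⟩ else ⟨i.val + 2, by omega⟩

/-- Insert two adjacent copies of a new largest letter after the first `j` letters of a word. -/
def insertMax (n j : ℕ) (σ : StWord n) : StWord (n + 1) := fun i =>
  if h : i.val < j ∧ i.val < 2 * n then (σ ⟨i.val, h.2⟩).castSucc
  else if h : j + 2 ≤ i.val then (σ ⟨i.val - 2, by omega⟩).castSucc
  else Fin.last n

/-- The positions of the ascent-plateaus of a word. -/
def plateaus (n : ℕ) (σ : StWord n) : Finset ℕ :=
  (Finset.Icc 2 (2 * n - 1)).filter
    (fun i => qval n σ (i - 1) < qval n σ i ∧ qval n σ i = qval n σ (i + 1))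

theorem card_plateaus (n : ℕ) (σ : StWord n) : (plateaus n σ).card = ap n σ := rfl

theorem skipPair_strictMono (n j : ℕ) : StrictMono (skipPair n j) := by
  intro a b h
  simp only [skipPair, Fin.lt_def] at *
  split_ifs <;> simp <;> omega

theorem insertMax_skipPair {n j : ℕ} (σ : StWord n) (i : Fin (2 * n)) :
    insertMax n j σ (skipPair n j i) = (σ i).castSucc := by
  unfold insertMax skipPair
  by_cases h : i.val < j
  · simp [h]
  · have h1 : ¬ (i.val + 2 < j) := by omega
    have h2 : j ≤ i.val := by omega
    simp [h, h1, h2]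

theorem insertMax_eq_last {n j : ℕ} (σ : StWord n) (hj : j ≤ 2 * n) (i : Fin (2 * (n + 1))) :
    insertMax n j σ i = Fin.last n ↔ i.val = j ∨ i.val = j + 1 := by
  unfold insertMax
  split_ifs with h h'
  · have := (σ ⟨i.val, h.2⟩).castSucc_ne_last
    constructor
    · intro h; exact absurd h this
    · omega
  · have := (σ ⟨i.val - 2, by omega⟩).castSucc_ne_last
    constructor
    · intro h; exact absurd h this
    · omega
  · simp only [true_iff]; omega

theorem exists_skipPair_eq {n j : ℕ} (i : Fin (2 * (n + 1))) (hj : j ≤ 2 * n)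
    (h0 : i.val ≠ j) (h1 : i.val ≠ j + 1) : ∃ k, skipPair n j k = i := by
  by_cases h : i.val < j
  · exact ⟨⟨i.val, by omega⟩, by simp [skipPair, h]⟩
  · refine ⟨⟨i.val - 2, by omega⟩, ?_⟩
    have h2 : ¬ (i.val - 2 < j) := by omega
    simp only [skipPair, h2, if_false, Fin.ext_iff]
    omega

theorem isStirling_insertMax_iff {n j : ℕ} (σ : StWord n) (hj : j ≤ 2 * n) :
    IsStirling (n + 1) (insertMax n j σ) ↔ IsStirling n σ := by
  have card_eq (k : Fin n) :
      (Finset.univ.filter (fun i => insertMax n j σ i = k.castSucc)).card =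
        (Finset.univ.filter (fun i => σ i = k)).card := by
    rw [← Finset.card_image_of_injective _ (skipPair_strictMono n j).injective]
    congr 1
    ext i
    simp only [mem_filter, mem_univ, true_and, mem_image]
    constructor
    · intro h
      have hl : ¬ (i.val = j ∨ i.val = j + 1) := by
        rw [← insertMax_eq_last σ hj, h]
        exact k.castSucc_ne_last
      push Not at hl
      obtain ⟨a, rfl⟩ := exists_skipPair_eq i hj hl.1 hl.2
      rw [insertMax_skipPair] at h
      exact ⟨a, Fin.castSucc_injective n h, rfl⟩
    · rintro ⟨a, h, rfl⟩
      rw [insertMax_skipPair, h]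
  constructor
  · rintro ⟨hc, hs⟩
    refine ⟨fun k => by rw [← card_eq, hc], fun a b c hab hbc h => ?_⟩
    have := hs _ _ _ (skipPair_strictMono n j hab) (skipPair_strictMono n j hbc)
    simp only [insertMax_skipPair, Fin.castSucc_inj, Fin.castSucc_lt_castSucc_iff] at this
    exact this h
  · rintro ⟨hc, hs⟩
    refine ⟨fun k => ?_, fun a b c hab hbc h => ?_⟩
    · induction k using Fin.lastCases with
      | cast k => rw [card_eq, hc]
      | last =>
        have : Finset.univ.filter (fun i => insertMax n j σ i = Fin.last n) =
            {⟨j, by omega⟩, ⟨j + 1, by omega⟩} := by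
          ext i
          simp [insertMax_eq_last σ hj, Fin.ext_iff]
        rw [this, Finset.card_pair (by simp [Fin.ext_iff])]
    · by_cases ha : insertMax n j σ a = Fin.last n
      · have hcl := h.symm.trans ha
        rw [insertMax_eq_last σ hj] at ha hcl
        simp only [Fin.lt_def] at hab hbc
        omega
      have hcl : insertMax n j σ c ≠ Fin.last n := h ▸ ha
      by_cases hb : insertMax n j σ b = Fin.last n
      · rw [hb]
        exact Fin.lt_last_iff_ne_last.2 ha
      rw [Ne, insertMax_eq_last σ hj, not_or] at hcl
      rw [insertMax_eq_last σ hj, not_or] at ha hb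
      obtain ⟨a, rfl⟩ := exists_skipPair_eq a hj ha.1 ha.2
      obtain ⟨b, rfl⟩ := exists_skipPair_eq b hj hb.1 hb.2
      obtain ⟨c, rfl⟩ := exists_skipPair_eq c hj hcl.1 hcl.2
      rw [(skipPair_strictMono n j).lt_iff_lt] at hab hbc
      simp only [insertMax_skipPair, Fin.castSucc_inj, Fin.castSucc_lt_castSucc_iff] at h ⊢
      exact hs a b c hab hbc h

theorem insertMax_injective {n j j' : ℕ} {σ σ' : StWord n} (hj : j ≤ 2 * n) (hj' : j' ≤ 2 * n)
    (h : insertMax n j σ = insertMax n j' σ') : j = j' ∧ σ = σ' := by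
  have e (i : ℕ) (hi : i < 2 * (n + 1)) : i = j ∨ i = j + 1 ↔ i = j' ∨ i = j' + 1 := by
    rw [← insertMax_eq_last σ hj ⟨i, hi⟩, h, insertMax_eq_last σ' hj']
  have e1 := e j (by omega)
  have e2 := e j' (by omega)
  obtain rfl : j = j' := by omega
  refine ⟨rfl, funext fun i => ?_⟩
  have := congrFun h (skipPair n j i)
  rwa [insertMax_skipPair, insertMax_skipPair, Fin.castSucc_inj] at this

theorem exists_insertMax_eq {n : ℕ} {τ : StWord (n + 1)} (hτ : IsStirling (n + 1) τ) :
    ∃ j ≤ 2 * n, ∃ σ : StWord n, insertMax n j σ = τ := by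
  obtain ⟨a, b, hab, h⟩ : ∃ a b, a < b ∧
      Finset.univ.filter (fun i => τ i = Fin.last n) = {a, b} := by
    obtain ⟨a, b, hne, h⟩ := Finset.card_eq_two.1 (hτ.1 (Fin.last n))
    rcases lt_or_gt_of_ne hne with hl | hl
    · exact ⟨a, b, hl, h⟩
    · exact ⟨b, a, hl, by rw [h, Finset.pair_comm]⟩
  have hmem (i) : τ i = Fin.last n ↔ i = a ∨ i = b := by
    simpa using Finset.ext_iff.1 h i
  have hb : b.val = a.val + 1 := by
    by_contra hb
    rw [Fin.lt_def] at hab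
    have := hτ.2 a ⟨a.val + 1, by omega⟩ b (by simp [Fin.lt_def]) (by simp [Fin.lt_def]; omega)
      (((hmem a).2 (.inl rfl)).trans ((hmem b).2 (.inr rfl)).symm)
    rw [(hmem a).2 (.inl rfl)] at this
    exact absurd this (Fin.le_last _).not_gt
  have hj : a.val ≤ 2 * n := by omega
  have hne (i) : τ (skipPair n a i) ≠ Fin.last n := by
    rw [Ne, hmem, Fin.ext_iff, Fin.ext_iff]
    unfold skipPair
    split_ifs <;> simp <;> omega
  refine ⟨a, hj, fun i => (τ (skipPair n a i)).castPred (hne i), funext fun i => ?_⟩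
  by_cases hi : i.val = a.val ∨ i.val = a.val + 1
  · rw [(insertMax_eq_last _ hj i).2 hi, eq_comm, hmem, Fin.ext_iff, Fin.ext_iff]
    omega
  · rw [not_or] at hi
    obtain ⟨k, rfl⟩ := exists_skipPair_eq i hj hi.1 hi.2
    rw [insertMax_skipPair, Fin.castSucc_castPred]

theorem sum_isStirling_succ {M : Type*} [AddCommMonoid M] (n : ℕ) (f : StWord (n + 1) → M) :
    ∑ τ with IsStirling (n + 1) τ, f τ =
      ∑ σ with IsStirling n σ, ∑ j ∈ range (2 * n + 1), f (insertMax n j σ) := by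
  rw [← Finset.sum_product']
  symm
  refine Finset.sum_bij (fun p _ => insertMax n p.2 p.1) ?_ ?_ ?_ (fun _ _ => rfl)
  · rintro ⟨σ, j⟩ h
    simp only [mem_product, mem_filter, mem_univ, true_and, mem_range] at h ⊢
    exact (isStirling_insertMax_iff σ (by omega)).2 h.1
  · rintro ⟨σ, j⟩ h ⟨σ', j'⟩ h' e
    simp only [mem_product, mem_filter, mem_univ, true_and, mem_range] at h h'
    obtain ⟨rfl, rfl⟩ := insertMax_injective (by omega) (by omega) e
    rfl
  · intro τ h
    simp only [mem_filter, mem_univ, true_and] at h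
    obtain ⟨j, hj, σ, rfl⟩ := exists_insertMax_eq h
    rw [isStirling_insertMax_iff σ hj] at h
    exact ⟨(σ, j), by simp [h]; omega, rfl⟩

theorem qval_le (n : ℕ) (σ : StWord n) (i : ℕ) : qval n σ i ≤ n := by
  unfold qval
  split_ifs
  · omega
  · omega

theorem qval_insertMax {n j : ℕ} (σ : StWord n) (hj : j ≤ 2 * n) (i : ℕ) :
    qval (n + 1) (insertMax n j σ) i =
      if i ≤ j then qval n σ i else if i ≤ j + 2 then n + 1 else qval n σ (i - 2) := by
  unfold qval insertMax
  split_ifs <;> grind [Fin.val_castSucc]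

theorem mem_plateaus {n : ℕ} {σ : StWord n} {i : ℕ} :
    i ∈ plateaus n σ ↔ (2 ≤ i ∧ i ≤ 2 * n - 1) ∧
      qval n σ (i - 1) < qval n σ i ∧ qval n σ i = qval n σ (i + 1) := by
  simp [plateaus]

theorem succ_notMem_plateaus {n : ℕ} {σ : StWord n} {i : ℕ} (h : i ∈ plateaus n σ) :
    i + 1 ∉ plateaus n σ := by
  rw [mem_plateaus] at *
  simp only [Nat.add_sub_cancel]
  omega

theorem ap_insertMax_zero {n : ℕ} (σ : StWord n) : ap (n + 1) (insertMax n 0 σ) = ap n σ := by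
  rw [← card_plateaus, ← card_plateaus,
    ← Finset.card_image_of_injective (plateaus n σ) (add_left_injective 2)]
  congr 1
  ext i
  simp only [mem_image, mem_plateaus, qval_insertMax σ (Nat.zero_le _)]
  constructor
  · rintro ⟨hi, h1, h2⟩
    have := qval_le n σ (i - 2)
    have h4 : 4 ≤ i := by
      by_contra h4
      split_ifs at h1 h2 <;> omega
    refine ⟨i - 2, ?_, by omega⟩
    obtain ⟨k, rfl⟩ : ∃ k, i = k + 4 := ⟨i - 4, by omega⟩
    simp at h1 h2 ⊢
    exact ⟨by omega, h1, h2⟩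
  · rintro ⟨k, ⟨hk, h1, h2⟩, rfl⟩
    obtain ⟨k, rfl⟩ : ∃ i, k = i + 2 := ⟨k - 2, by omega⟩
    simp at h1 h2 ⊢
    exact ⟨by omega, h1, h2⟩

theorem ap_insertMax {n j : ℕ} (σ : StWord n) (hj : j ≤ 2 * n) (hj1 : 1 ≤ j) :
    ap (n + 1) (insertMax n j σ) =
      if j ∈ plateaus n σ ∨ j + 1 ∈ plateaus n σ then ap n σ else ap n σ + 1 := by
  have key : plateaus (n + 1) (insertMax n j σ) =
      insert (j + 1) ((((plateaus n σ).erase j).erase (j + 1)).image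
        (fun i => if i < j then i else i + 2)) := by
    ext i
    simp only [mem_insert, mem_image, mem_erase, mem_plateaus, qval_insertMax σ hj]
    constructor
    · rintro ⟨hi, h1, h2⟩
      by_cases hij : i = j + 1
      · exact .inl hij
      right
      have q1 := qval_le n σ i
      have q2 := qval_le n σ (i - 2)
      by_cases hlt : i < j
      · refine ⟨i, ⟨by omega, by omega, by omega, ?_⟩, by simp [hlt]⟩
        rw [if_pos (by omega), if_pos (by omega)] at h1 h2
        exact ⟨h1, h2⟩
      · have h4 : j + 4 ≤ i := by
          by_contra h4
          split_ifs at h1 h2 <;> omega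
        obtain ⟨k, rfl⟩ : ∃ k, i = k + 4 := ⟨i - 4, by omega⟩
        refine ⟨k + 2, ⟨by omega, by omega, by omega, ?_⟩, by
          rw [if_neg (by omega)]⟩
        rw [if_neg (by omega), if_neg (by omega), if_neg (by omega), if_neg (by omega)] at h1
        rw [if_neg (by omega), if_neg (by omega), if_neg (by omega), if_neg (by omega)] at h2
        exact ⟨h1, h2⟩
    · rintro (rfl | ⟨k, ⟨hk1, hk2, hk, h1, h2⟩, rfl⟩)
      · have := qval_le n σ j
        simp
        omega
      · by_cases hlt : k < j
        · simp only [hlt, if_true]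
          rw [if_pos (by omega), if_pos (by omega), if_pos (by omega)]
          exact ⟨by omega, h1, h2⟩
        · simp only [hlt, if_false]
          obtain ⟨k, rfl⟩ : ∃ i, k = i + 2 := ⟨k - 2, by omega⟩
          rw [if_neg (by omega), if_neg (by omega), if_neg (by omega), if_neg (by omega),
            if_neg (by omega), if_neg (by omega)]
          exact ⟨by omega, h1, h2⟩
  rw [← card_plateaus, ← card_plateaus, key, Finset.card_insert_of_notMem,
    Finset.card_image_of_injective]
  · by_cases h : j ∈ plateaus n σ
    · have h' := succ_notMem_plateaus h
      have : 0 < (plateaus n σ).card := Finset.card_pos.2 ⟨_, h⟩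
      rw [Finset.erase_eq_of_notMem (fun h => h' (mem_of_mem_erase h)),
        Finset.card_erase_of_mem h, if_pos (.inl h)]
      omega
    · rw [Finset.erase_eq_of_notMem h]
      by_cases h' : j + 1 ∈ plateaus n σ
      · have : 0 < (plateaus n σ).card := Finset.card_pos.2 ⟨_, h'⟩
        rw [Finset.card_erase_of_mem h', if_pos (.inr h')]
        omega
      · rw [Finset.erase_eq_of_notMem h', if_neg (by tauto)]
  · intro a b h
    simp only at h
    split_ifs at h <;> omega
  · simp only [mem_image, not_exists, not_and]
    intro k hk h
    simp only [mem_erase] at hk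
    split_ifs at h <;> omega

theorem card_gaps_plateaus {n : ℕ} (σ : StWord n) :
    ((Icc 1 (2 * n)).filter (fun j => j ∈ plateaus n σ ∨ j + 1 ∈ plateaus n σ)).card =
      2 * ap n σ := by
  have : (Icc 1 (2 * n)).filter (fun j => j ∈ plateaus n σ ∨ j + 1 ∈ plateaus n σ) =
      plateaus n σ ∪ (plateaus n σ).image (fun i => i - 1) := by
    ext j
    simp only [mem_filter, mem_Icc, mem_union, mem_image]
    constructor
    · rintro ⟨-, h | h⟩
      · exact .inl h
      · exact .inr ⟨_, h, rfl⟩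
    · rintro (h | ⟨k, h, rfl⟩)
      · have := (mem_plateaus.1 h).1
        exact ⟨by omega, .inl h⟩
      · have := (mem_plateaus.1 h).1
        exact ⟨by omega, .inr (by rwa [Nat.sub_add_cancel (by omega)])⟩
  rw [this, Finset.card_union_of_disjoint, Finset.card_image_of_injOn, card_plateaus, two_mul]
  · intro a ha b hb h
    have := (mem_plateaus.1 ha).1
    have := (mem_plateaus.1 hb).1
    simp only at h
    omega
  · rw [Finset.disjoint_left]
    rintro a ha hb
    obtain ⟨k, hk, rfl⟩ := mem_image.1 hb
    have := (mem_plateaus.1 hk).1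
    apply succ_notMem_plateaus ha
    rwa [Nat.sub_add_cancel (by omega)]

theorem sum_X_pow_ap_insertMax {n : ℕ} (σ : StWord n) :
    ∑ j ∈ Icc 1 (2 * n), (X : ℝ[X]) ^ ap (n + 1) (insertMax n j σ) =
      C (2 * (n : ℝ)) * X * X ^ ap n σ + 2 * X * (1 - X) * derivative (X ^ ap n σ) := by
  have h1 : ∑ j ∈ Icc 1 (2 * n), (X : ℝ[X]) ^ ap (n + 1) (insertMax n j σ) =
      ∑ j ∈ Icc 1 (2 * n), (X ^ (ap n σ + 1) +
        if j ∈ plateaus n σ ∨ j + 1 ∈ plateaus n σ then X ^ ap n σ - X ^ (ap n σ + 1) else 0) := by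
    refine Finset.sum_congr rfl fun j hj => ?_
    rw [mem_Icc] at hj
    rw [ap_insertMax σ hj.2 hj.1]
    split_ifs <;> ring
  rw [h1, Finset.sum_add_distrib, ← Finset.sum_filter, Finset.sum_const, Finset.sum_const,
    card_gaps_plateaus, Nat.card_Icc]
  have h2 : C (2 : ℝ) = 2 := map_ofNat C 2
  rcases ap n σ with _ | a
  · simp [h2]
  · simp [h2]
    ring

theorem IsStirling.qval_one_le_qval_two {n : ℕ} (hn : 1 ≤ n) {σ : StWord n}
    (hσ : IsStirling n σ) : qval n σ 1 ≤ qval n σ 2 := by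
  unfold qval
  rw [dif_pos (by omega), dif_pos (by omega)]
  simp only [Nat.sub_self, Nat.reduceSub, add_le_add_iff_right, Fin.val_fin_le]
  by_contra! h
  obtain ⟨c, hc, hc0⟩ := Finset.exists_mem_ne (by rw [hσ.1 (σ ⟨0, by omega⟩)]; norm_num)
    (⟨0, by omega⟩ : Fin (2 * n))
  simp only [mem_filter, mem_univ, true_and] at hc
  have hc1 : c ≠ ⟨1, by omega⟩ := by
    intro h1
    exact h.ne (h1 ▸ hc)
  rw [Ne, Fin.ext_iff] at hc0 hc1
  simp only at hc0 hc1
  exact h.not_gt (hσ.2 ⟨0, by omega⟩ ⟨1, by omega⟩ c (by simp [Fin.lt_def])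
    (by rw [Fin.lt_def]; simp only; omega) hc.symm)

theorem LEpoly_eq_sum_ite (n : ℕ) : LEpoly n =
    ∑ σ with IsStirling n σ, if qval n σ 1 < qval n σ 2 then X ^ ap n σ else 0 := by
  rw [LEpoly, ← Finset.filter_filter, Finset.sum_filter]

theorem LOpoly_eq_sum_ite (n : ℕ) : LOpoly n =
    ∑ σ with IsStirling n σ, if qval n σ 1 = qval n σ 2 then X ^ ap n σ else 0 := by
  rw [LOpoly, ← Finset.filter_filter, Finset.sum_filter]

theorem sum_range_two_mul_succ {M : Type*} [AddCommMonoid M] {n : ℕ} (hn : 1 ≤ n) (g : ℕ → M) :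
    ∑ j ∈ range (2 * n + 1), g j = g 0 + (g 1 + ∑ j ∈ Icc 2 (2 * n), g j) := by
  have h0 : range (2 * n + 1) = insert 0 (insert 1 (Icc 2 (2 * n))) := by
    ext
    simp
    omega
  rw [h0, Finset.sum_insert (by simp), Finset.sum_insert (by simp)]

theorem qval_insertMax_zero {n : ℕ} (σ : StWord n) :
    qval (n + 1) (insertMax n 0 σ) 1 = qval (n + 1) (insertMax n 0 σ) 2 := by
  simp [qval_insertMax σ (Nat.zero_le _)]

theorem qval_insertMax_one {n : ℕ} (hn : 1 ≤ n) (σ : StWord n) :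
    qval (n + 1) (insertMax n 1 σ) 1 < qval (n + 1) (insertMax n 1 σ) 2 := by
  have := qval_le n σ 1
  simp [qval_insertMax σ (show 1 ≤ 2 * n by omega)]
  omega

theorem qval_insertMax_of_two_le {n j : ℕ} (σ : StWord n) (hj : j ≤ 2 * n) (hj2 : 2 ≤ j) {i : ℕ}
    (hi : i ≤ 2) : qval (n + 1) (insertMax n j σ) i = qval n σ i := by
  rw [qval_insertMax σ hj, if_pos (by omega)]

theorem ap_insertMax_one {n : ℕ} (hn : 1 ≤ n) {σ : StWord n} (h : qval n σ 1 = qval n σ 2) :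
    ap (n + 1) (insertMax n 1 σ) = ap n σ + 1 := by
  rw [ap_insertMax σ (by omega) le_rfl, if_neg]
  simp [mem_plateaus, h]

theorem sum_Icc_two_X_pow {n : ℕ} (hn : 1 ≤ n) (σ : StWord n) :
    ∑ j ∈ Icc 2 (2 * n), (X : ℝ[X]) ^ ap (n + 1) (insertMax n j σ) =
      C (2 * (n : ℝ)) * X * X ^ ap n σ + 2 * X * (1 - X) * derivative (X ^ ap n σ) -
        X ^ ap (n + 1) (insertMax n 1 σ) := by
  have h1 : Icc 1 (2 * n) = insert 1 (Icc 2 (2 * n)) := by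
    ext
    simp
    omega
  rw [← sum_X_pow_ap_insertMax, h1, Finset.sum_insert (by simp), add_sub_cancel_left]

theorem sum_ascent_insertMax {n : ℕ} (hn : 1 ≤ n) {σ : StWord n} (hσ : IsStirling n σ) :
    (∑ j ∈ range (2 * n + 1),
      if qval (n + 1) (insertMax n j σ) 1 < qval (n + 1) (insertMax n j σ) 2 then
        (X : ℝ[X]) ^ ap (n + 1) (insertMax n j σ) else 0) =
      let E : ℝ[X] := if qval n σ 1 < qval n σ 2 then X ^ ap n σ else 0
      let O : ℝ[X] := if qval n σ 1 = qval n σ 2 then X ^ ap n σ else 0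
      C (2 * (n : ℝ)) * X * E + 2 * X * (1 - X) * derivative E + X * O := by
  have h2 : ∀ j ∈ Icc 2 (2 * n),
      (if qval (n + 1) (insertMax n j σ) 1 < qval (n + 1) (insertMax n j σ) 2 then
        (X : ℝ[X]) ^ ap (n + 1) (insertMax n j σ) else 0) =
      if qval n σ 1 < qval n σ 2 then X ^ ap (n + 1) (insertMax n j σ) else 0 := by
    intro j hj
    rw [mem_Icc] at hj
    rw [qval_insertMax_of_two_le σ hj.2 hj.1 (by norm_num),
      qval_insertMax_of_two_le σ hj.2 hj.1 le_rfl]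
  rw [sum_range_two_mul_succ hn, if_neg (qval_insertMax_zero σ).not_lt,
    if_pos (qval_insertMax_one hn σ), Finset.sum_congr rfl h2]
  rcases (hσ.qval_one_le_qval_two hn).lt_or_eq with h | h
  · simp only [h, h.ne, if_true, if_false]
    rw [sum_Icc_two_X_pow hn]
    ring
  · simp only [ap_insertMax_one hn h]
    simp [h]
    ring

theorem sum_plateau_insertMax {n : ℕ} (hn : 1 ≤ n) {σ : StWord n} (hσ : IsStirling n σ) :
    (∑ j ∈ range (2 * n + 1),
      if qval (n + 1) (insertMax n j σ) 1 = qval (n + 1) (insertMax n j σ) 2 then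
        (X : ℝ[X]) ^ ap (n + 1) (insertMax n j σ) else 0) =
      let E : ℝ[X] := if qval n σ 1 < qval n σ 2 then X ^ ap n σ else 0
      let O : ℝ[X] := if qval n σ 1 = qval n σ 2 then X ^ ap n σ else 0
      (C (2 * (n : ℝ) - 1) * X + 1) * O + 2 * X * (1 - X) * derivative O + E := by
  have h2 : ∀ j ∈ Icc 2 (2 * n),
      (if qval (n + 1) (insertMax n j σ) 1 = qval (n + 1) (insertMax n j σ) 2 then
        (X : ℝ[X]) ^ ap (n + 1) (insertMax n j σ) else 0) =
      if qval n σ 1 = qval n σ 2 then X ^ ap (n + 1) (insertMax n j σ) else 0 := by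
    intro j hj
    rw [mem_Icc] at hj
    rw [qval_insertMax_of_two_le σ hj.2 hj.1 (by norm_num),
      qval_insertMax_of_two_le σ hj.2 hj.1 le_rfl]
  rw [sum_range_two_mul_succ hn, if_pos (qval_insertMax_zero σ),
    if_neg (qval_insertMax_one hn σ).ne, Finset.sum_congr rfl h2, ap_insertMax_zero]
  rcases (hσ.qval_one_le_qval_two hn).lt_or_eq with h | h
  · simp [h, h.ne]
  · simp only [h, lt_irrefl, if_true, if_false]
    rw [sum_Icc_two_X_pow hn, ap_insertMax_one hn h, C_sub, C_1]
    ring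

theorem ap_one (σ : StWord 1) : ap 1 σ = 0 := by
  simp [ap]

theorem qval_one_one_eq (σ : StWord 1) : qval 1 σ 1 = qval 1 σ 2 := by
  simp [qval]

theorem isStirling_one (σ : StWord 1) : IsStirling 1 σ := by
  refine ⟨fun k => ?_, fun a b c hab hbc => by omega⟩
  rw [Finset.filter_true_of_mem fun _ _ => Subsingleton.elim _ _]
  rfl

/-- For every `n ≥ 1`, the polynomials `L_n^E` and `L_n^O` satisfy the Eulerian
recurrence system
`L_{n+1}^E = 2nx·L_n^E + 2x(1-x)(L_n^E)' + x·L_n^O`,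
`L_{n+1}^O = ((2n-1)x+1)·L_n^O + 2x(1-x)(L_n^O)' + L_n^E`,
with initial conditions `L_1^E = 0` and `L_1^O = 1`. -/
theorem LE_LO_recurrence_system :
    LEpoly 1 = 0 ∧ LOpoly 1 = 1 ∧
    ∀ n : ℕ, 1 ≤ n →
      LEpoly (n + 1) =
        Polynomial.C (2 * (n : ℝ)) * X * LEpoly n +
          2 * X * (1 - X) * derivative (LEpoly n) + X * LOpoly n ∧
      LOpoly (n + 1) =
        (Polynomial.C (2 * (n : ℝ) - 1) * X + 1) * LOpoly n +
          2 * X * (1 - X) * derivative (LOpoly n) + LEpoly n := by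
  refine ⟨?_, ?_, fun n hn => ⟨?_, ?_⟩⟩
  · simp [LEpoly, qval_one_one_eq]
  · simp [LOpoly, qval_one_one_eq, isStirling_one, ap_one]
  · simp only [LEpoly_eq_sum_ite, LOpoly_eq_sum_ite, sum_isStirling_succ, Finset.mul_sum,
      derivative_sum, ← Finset.sum_add_distrib]
    exact Finset.sum_congr rfl fun σ hσ => sum_ascent_insertMax hn (mem_filter.1 hσ).2
  · simp only [LEpoly_eq_sum_ite, LOpoly_eq_sum_ite, sum_isStirling_succ, Finset.mul_sum,
      derivative_sum, ← Finset.sum_add_distrib]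
    exact Finset.sum_congr rfl fun σ hσ => sum_plateau_insertMax hn (mem_filter.1 hσ).2
end
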